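/- arXiv:math-ph/0002010 — 3 statements merged into one kernel-verified Lean document; each statement's English description precedes it below -/
import Mathlib

section
/- Let φ : [0,1] → ℝ be C² with 0 < c ≤ |φ''(x)| ≤ C' for all x. Fix t ≠ 0 and T > 0, and set N_m = ⌊m (log m)⁵⌋ for m ≥ 2. For N ∈ ℕ and α, β ∈ ℝ and Schwartz f with compactly supported Fourier transform, let ρ^{(N)}_{t,α,β}(f) = (1/N²) Σ_{ℓ∈ℤ} f̂(2πℓ/N) |Σ_{j=1}^N exp(i t ℓ N (α φ(j/N) + β j/N))|². Then for Lebesgue-almost every (α,β) ∈ [−T,T]², for every Schwartz function f with f̂ compactly supported, lim_{m→∞} ρ^{(N_m)}_{t,α,β}(f) = f(0) + f̂(0). -/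
open MeasureTheory Filter Topology Real

/-- Fourier transform with the convention `f̂(ξ) = ∫ f(x) e^{-i x ξ} dx`. -/
noncomputable def FT (f : ℝ → ℝ) (ξ : ℝ) : ℂ :=
  ∫ x : ℝ, (f x : ℂ) * Complex.exp (-(Complex.I * x * ξ))

open scoped FourierTransform ContDiff in
/-- Band-limited majorant of the indicator of `[-T, T]`. -/
lemma exists_bandlimited_majorant (T δ : ℝ) (hT : 0 < T) (hδ : 0 < δ) :
    ∃ k : ℝ → ℝ, Integrable k ∧ (∀ x, 0 ≤ k x) ∧ (∀ x ∈ Set.Icc (-T) T, 1 ≤ k x) ∧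
      ∀ ξ : ℝ, δ ≤ |ξ| → ∫ x, (k x : ℂ) * Complex.exp (Complex.I * (ξ * x : ℝ)) = 0 := by
  obtain ⟨r, hr, hrδ, hrT⟩ : ∃ r : ℝ, 0 < r ∧ 4 * π * r ≤ δ ∧ 4 * π * T * r ≤ 1 := by
    refine ⟨min (δ / (4 * π)) (1 / (4 * π * T)), by positivity, ?_, ?_⟩
    · calc 4 * π * min (δ / (4 * π)) (1 / (4 * π * T)) ≤ 4 * π * (δ / (4 * π)) := by
            gcongr; exact min_le_left _ _
        _ = δ := by field_simp
    · calc 4 * π * T * min (δ / (4 * π)) (1 / (4 * π * T)) ≤ 4 * π * T * (1 / (4 * π * T)) := by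
            gcongr; exact min_le_right _ _
        _ = 1 := by field_simp
  let B : ContDiffBump (0 : ℝ) := ⟨r / 2, r, by positivity, by linarith⟩
  let b₀ : ℝ → ℝ := B.normed volume
  have hb₀ : HasCompactSupport (fun x => (b₀ x : ℂ)) :=
    B.hasCompactSupport_normed.comp_left (g := fun x : ℝ => (x : ℂ)) (by simp)
  have hb₀' : ContDiff ℝ ∞ (fun x => (b₀ x : ℂ)) :=
    Complex.ofRealCLM.contDiff.comp B.contDiff_normed
  let b : SchwartzMap ℝ ℂ := hb₀.toSchwartzMap hb₀'
  have hb : ∀ x, b x = (b₀ x : ℂ) := fun x => rfl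
  have hsupp : ∀ x, r ≤ |x| → b₀ x = 0 := by
    intro x hx
    by_contra h
    have : x ∈ Function.support (B.normed volume) := h
    rw [B.support_normed_eq] at this
    simp [B] at this
    linarith
  have hnn : ∀ x, 0 ≤ b₀ x := fun x => B.nonneg_normed x
  have hbint : Integrable b₀ := B.integrable_normed
  have hone : ∫ x, b₀ x = 1 := B.integral_normed
  have hfour : ∀ x, 𝓕 b x = ∫ y, Complex.exp (((-2 * π * y * x : ℝ) : ℂ) * Complex.I) *
      (b₀ y : ℂ) := by
    intro x
    rw [SchwartzMap.fourier_coe, Real.fourier_real_eq_integral_exp_smul]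
    simp [hb]
  have hlow : ∀ x ∈ Set.Icc (-T) T, 1 / 2 ≤ ‖𝓕 b x‖ := by
    intro x hx
    have habs : |x| ≤ T := abs_le.2 hx
    have h1 : ‖𝓕 b x - 1‖ ≤ ∫ y, (1 / 2) * b₀ y := by
      have : 𝓕 b x - 1 = ∫ y, (Complex.exp (((-2 * π * y * x : ℝ) : ℂ) * Complex.I) - 1)
          * (b₀ y : ℂ) := by
        have h1 : (1 : ℂ) = ∫ y, (b₀ y : ℂ) := by
          rw [integral_complex_ofReal, hone]; simp
        rw [hfour]
        conv_lhs => rw [h1]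
        rw [← integral_sub]
        · simp_rw [sub_mul, one_mul]
        · refine Integrable.bdd_mul (c := 1) hbint.ofReal (by fun_prop) ?_
          filter_upwards with y
          rw [Complex.norm_exp_ofReal_mul_I]
        · exact hbint.ofReal
      rw [this]
      refine norm_integral_le_of_norm_le (hbint.const_mul _) ?_
      filter_upwards with y
      rw [norm_mul, Complex.norm_real, Real.norm_of_nonneg (hnn y)]
      by_cases hy : r ≤ |y|
      · simp [hsupp y hy]
      · push Not at hy
        refine mul_le_mul_of_nonneg_right ?_ (hnn y)
        have := Real.norm_exp_I_mul_ofReal_sub_one_le (x := -2 * π * y * x)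
        rw [mul_comm] at this
        refine this.trans ?_
        rw [Real.norm_eq_abs]
        calc |-2 * π * y * x| = 2 * π * |y| * |x| := by
              rw [abs_mul, abs_mul, abs_mul, abs_of_pos pi_pos]; norm_num
          _ ≤ 2 * π * r * T := by gcongr
          _ ≤ 1 / 2 := by linarith
    rw [integral_const_mul, hone] at h1
    have h2 : ‖(1 : ℂ)‖ - ‖𝓕 b x‖ ≤ ‖(1 : ℂ) - 𝓕 b x‖ := norm_sub_norm_le _ _
    rw [norm_sub_rev] at h2
    simp at h2 h1
    linarith
  have hbsq : Integrable fun x => ‖𝓕 b x‖ ^ 2 :=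
    ((𝓕 b).memLp 2 volume).integrable_norm_pow (by norm_num)
  refine ⟨fun x => 4 * ‖𝓕 b x‖ ^ 2, hbsq.const_mul _, fun x => by positivity, ?_, ?_⟩
  · intro x hx
    have := hlow x hx
    show 1 ≤ 4 * ‖𝓕 b x‖ ^ 2
    nlinarith
  · intro ξ hξ
    have hξ' : 2 * r ≤ |-ξ / (2 * π)| := by
      rw [abs_div, abs_neg, abs_of_pos (by positivity : 0 < 2 * π), le_div_iff₀ (by positivity)]
      linarith
    set a := -ξ / (2 * π) with ha
    have hshift : ∀ x, 𝓕 (b.compSubConstCLM ℂ a) x =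
        Complex.exp (Complex.I * (ξ * x : ℝ)) * 𝓕 b x := by
      intro x
      rw [hfour, SchwartzMap.fourier_coe, Real.fourier_real_eq_integral_exp_smul,
        ← integral_const_mul, ← integral_add_right_eq_self _ a]
      congr 1
      ext y
      simp only [SchwartzMap.compSubConstCLM_apply, hb, smul_eq_mul, add_sub_cancel_right]
      rw [← mul_assoc, ← Complex.exp_add]
      congr 2
      have : ξ = -(2 * π) * a := by rw [ha]; field_simp
      rw [this]; push_cast; ring
    have hP := SchwartzMap.integral_inner_fourier_fourier b (b.compSubConstCLM ℂ a)
    have hz : ∫ x, inner ℂ (b x) ((b.compSubConstCLM ℂ a) x) = 0 := by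
      rw [← integral_zero ℝ ℂ]
      congr 1
      ext x
      simp only [SchwartzMap.compSubConstCLM_apply, hb]
      by_cases h : r ≤ |x|
      · simp [hsupp x h]
      · rw [hsupp (x - a)]
        · simp
        · push Not at h
          have := abs_sub_abs_le_abs_sub a x
          rw [abs_sub_comm] at this
          linarith
    rw [hz] at hP
    rw [← mul_zero 4, ← hP, ← integral_const_mul]
    congr 1
    ext x
    rw [hshift]
    simp only [RCLike.inner_apply]
    rw [mul_assoc, Complex.mul_conj, Complex.normSq_eq_norm_sq]
    push_cast; ring

/-- Integrating the square of an exponential sum in two variables against a product weight. -/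
lemma integral_weight_norm_sq_expSum_le {ι : Type*} (s : Finset ι) (a : ι → ℂ) (lam mu : ι → ℝ)
    {k : ℝ → ℝ} {δ B : ℝ} (hk : Integrable k) (hk0 : ∀ x, 0 ≤ k x)
    (hkδ : ∀ ξ : ℝ, δ ≤ |ξ| → ∫ x, (k x : ℂ) * Complex.exp (Complex.I * (ξ * x : ℝ)) = 0)
    (ha : ∀ i ∈ s, ‖a i‖ ≤ B) :
    Integrable (fun p : ℝ × ℝ => k p.1 * k p.2 *
        ‖∑ i ∈ s, a i * Complex.exp (Complex.I * (lam i * p.1 + mu i * p.2 : ℝ))‖ ^ 2) ∧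
    ∫ p : ℝ × ℝ, k p.1 * k p.2 *
        ‖∑ i ∈ s, a i * Complex.exp (Complex.I * (lam i * p.1 + mu i * p.2 : ℝ))‖ ^ 2 ≤
      B ^ 2 * (∫ x, k x) ^ 2 *
        {q ∈ s ×ˢ s | |lam q.1 - lam q.2| < δ ∧ |mu q.1 - mu q.2| < δ}.card := by
  set κ : ℝ → ℂ := fun ξ => ∫ x, (k x : ℂ) * Complex.exp (Complex.I * (ξ * x : ℝ)) with hκ
  have hκA : ∀ ξ, ‖κ ξ‖ ≤ ∫ x, k x := by
    intro ξ
    refine norm_integral_le_of_norm_le hk ?_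
    filter_upwards with x
    rw [norm_mul, mul_comm Complex.I, Complex.norm_exp_ofReal_mul_I, Complex.norm_real,
      Real.norm_of_nonneg (hk0 x), mul_one]
  have hA0 : 0 ≤ ∫ x, k x := integral_nonneg hk0
  have hexp : ∀ ξ : ℝ, Integrable fun x => (k x : ℂ) * Complex.exp (Complex.I * (ξ * x : ℝ)) := by
    intro ξ
    refine Integrable.mul_bdd (c := 1) hk.ofReal (by fun_prop) ?_
    filter_upwards with x
    rw [mul_comm Complex.I, Complex.norm_exp_ofReal_mul_I]
  have hpt : ∀ p : ℝ × ℝ, ((k p.1 * k p.2 *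
      ‖∑ i ∈ s, a i * Complex.exp (Complex.I * (lam i * p.1 + mu i * p.2 : ℝ))‖ ^ 2 : ℝ) : ℂ) =
      ∑ q ∈ s ×ˢ s, a q.1 * (starRingEnd ℂ) (a q.2) *
        (((k p.1 : ℂ) * Complex.exp (Complex.I * ((lam q.1 - lam q.2) * p.1 : ℝ))) *
         ((k p.2 : ℂ) * Complex.exp (Complex.I * ((mu q.1 - mu q.2) * p.2 : ℝ)))) := by
    intro p
    rw [Complex.ofReal_mul, Complex.ofReal_pow, ← Complex.mul_conj', map_sum, Finset.sum_mul_sum,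
      ← Finset.sum_product', Finset.mul_sum]
    refine Finset.sum_congr rfl fun q _ => ?_
    rw [map_mul, ← Complex.exp_conj, map_mul, Complex.conj_I, Complex.conj_ofReal]
    have : Complex.exp (Complex.I * (lam q.1 * p.1 + mu q.1 * p.2 : ℝ)) *
        Complex.exp (-Complex.I * (lam q.2 * p.1 + mu q.2 * p.2 : ℝ)) =
        Complex.exp (Complex.I * ((lam q.1 - lam q.2) * p.1 : ℝ)) *
        Complex.exp (Complex.I * ((mu q.1 - mu q.2) * p.2 : ℝ)) := by
      rw [← Complex.exp_add, ← Complex.exp_add]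
      congr 1
      push_cast; ring
    push_cast at this ⊢
    linear_combination (k p.1 * k p.2 * a q.1 * (starRingEnd ℂ) (a q.2)) * this
  have hI : ∀ q : ι × ι, Integrable fun p : ℝ × ℝ => a q.1 * (starRingEnd ℂ) (a q.2) *
        (((k p.1 : ℂ) * Complex.exp (Complex.I * ((lam q.1 - lam q.2) * p.1 : ℝ))) *
         ((k p.2 : ℂ) * Complex.exp (Complex.I * ((mu q.1 - mu q.2) * p.2 : ℝ)))) :=
    fun q => ((hexp _).mul_prod (hexp _)).const_mul _
  have hsumI := integrable_finsetSum (s ×ˢ s) (fun q _ => hI q)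
  simp_rw [← hpt] at hsumI
  refine ⟨hsumI.re, ?_⟩
  have hval : ((∫ p : ℝ × ℝ, k p.1 * k p.2 *
        ‖∑ i ∈ s, a i * Complex.exp (Complex.I * (lam i * p.1 + mu i * p.2 : ℝ))‖ ^ 2 : ℝ) : ℂ)
      = ∑ q ∈ s ×ˢ s, a q.1 * (starRingEnd ℂ) (a q.2) *
        (κ (lam q.1 - lam q.2) * κ (mu q.1 - mu q.2)) := by
    rw [← integral_complex_ofReal]
    simp_rw [hpt]
    rw [integral_finsetSum _ (fun q _ => hI q)]
    refine Finset.sum_congr rfl fun q _ => ?_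
    rw [integral_const_mul]
    congr 1
    exact integral_prod_mul
      (fun x => (k x : ℂ) * Complex.exp (Complex.I * ((lam q.1 - lam q.2) * x : ℝ)))
      (fun x => (k x : ℂ) * Complex.exp (Complex.I * ((mu q.1 - mu q.2) * x : ℝ)))
  refine (le_abs_self _).trans ?_
  rw [← Real.norm_eq_abs, ← Complex.norm_real, hval]
  refine (norm_sum_le _ _).trans ?_
  rw [Finset.card_filter, Nat.cast_sum, Finset.mul_sum]
  refine Finset.sum_le_sum fun q hq => ?_
  obtain ⟨h1, h2⟩ := Finset.mem_product.1 hq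
  split_ifs with h
  · rw [norm_mul, norm_mul, norm_mul, RCLike.norm_conj]
    have hB : 0 ≤ B := (norm_nonneg _).trans (ha _ h1)
    calc ‖a q.1‖ * ‖a q.2‖ * (‖κ (lam q.1 - lam q.2)‖ * ‖κ (mu q.1 - mu q.2)‖)
        ≤ B * B * ((∫ x, k x) * (∫ x, k x)) := by
          gcongr
          exacts [ha _ h1, ha _ h2, hκA _, hκA _]
      _ = _ := by push_cast; ring
  · rw [not_and_or, not_lt, not_lt] at h
    rcases h with h | h
    · rw [show κ _ = 0 from hkδ _ h]; simp
    · rw [show κ (mu q.1 - mu q.2) = 0 from hkδ _ h]; simp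

lemma mixed_difference_ge_of_convexOn {f : ℝ → ℝ} {s : Set ℝ} (hf : ConvexOn ℝ s f) {x u v : ℝ}
    (hu : 0 ≤ u) (hv : 0 ≤ v) (hx : x ∈ s) (hxuv : x + u + v ∈ s) :
    0 ≤ f (x + u + v) - f (x + u) - f (x + v) + f x := by
  rcases (add_nonneg hu hv).eq_or_lt with h | h
  · have hu0 : u = 0 := by linarith
    have hv0 : v = 0 := by linarith
    simp [hu0, hv0]
  · have e1 := hf.2 hx hxuv (div_nonneg hv h.le) (div_nonneg hu h.le)
      (by field_simp; ring)
    have e2 := hf.2 hx hxuv (div_nonneg hu h.le) (div_nonneg hv h.le)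
      (by field_simp)
    simp only [smul_eq_mul] at e1 e2
    rw [show v / (u + v) * x + u / (u + v) * (x + u + v) = x + u by field_simp; ring] at e1
    rw [show u / (u + v) * x + v / (u + v) * (x + u + v) = x + v by field_simp; ring] at e2
    have : v / (u + v) + u / (u + v) = 1 := by field_simp; ring
    have e3 : v / (u + v) * f x + u / (u + v) * f x = f x := by rw [← add_mul, this, one_mul]
    have e4 : v / (u + v) * f (x + u + v) + u / (u + v) * f (x + u + v) = f (x + u + v) := by
      rw [← add_mul, this, one_mul]
    linarith

lemma mixed_difference_ge {φ : ℝ → ℝ} {c : ℝ} (hφ : ContDiffOn ℝ 2 φ (Set.Icc 0 1))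
    (hφ'' : ∀ x ∈ Set.Icc (0:ℝ) 1, c ≤ iteratedDerivWithin 2 φ (Set.Icc 0 1) x) {x u v : ℝ}
    (hu : 0 ≤ u) (hv : 0 ≤ v) (hx : x ∈ Set.Icc (0:ℝ) 1) (hxuv : x + u + v ∈ Set.Icc (0:ℝ) 1) :
    c * u * v ≤ φ (x + u + v) - φ (x + u) - φ (x + v) + φ x := by
  have hconv : ConvexOn ℝ (Set.Icc 0 1) (fun y => φ y - c / 2 * y ^ 2) := by
    have hloc : ∀ y ∈ Set.Ioo (0:ℝ) 1, ContDiffAt ℝ 2 φ y := fun y hy =>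
      hφ.contDiffAt (Icc_mem_nhds hy.1 hy.2)
    have hd : ∀ y ∈ Set.Ioo (0:ℝ) 1, deriv (fun y => φ y - c / 2 * y ^ 2) y =
        deriv φ y - c * y := by
      intro y hy
      have h1 := ((hloc y hy).differentiableAt (by norm_num)).hasDerivAt
      have h2 := ((hasDerivAt_id y).pow 2).const_mul (c / 2)
      have := (h1.sub h2).deriv
      simp only [id] at this
      refine Eq.trans ?_ (this.trans (by norm_num; ring))
      rfl
    have hd1 : ∀ y ∈ Set.Ioo (0:ℝ) 1, DifferentiableAt ℝ (deriv φ) y := by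
      intro y hy
      exact (((hφ.mono Set.Ioo_subset_Icc_self).deriv_of_isOpen isOpen_Ioo (m := 1)
        (by norm_num)).differentiableOn (by norm_num)).differentiableAt (Ioo_mem_nhds hy.1 hy.2)
    have hev : ∀ y ∈ Set.Ioo (0:ℝ) 1, deriv (fun y => φ y - c / 2 * y ^ 2) =ᶠ[𝓝 y]
        fun y => deriv φ y - c * y := fun y hy => by
      filter_upwards [Ioo_mem_nhds hy.1 hy.2] with z hz using hd z hz
    apply convexOn_of_deriv2_nonneg (convex_Icc 0 1)
    · exact hφ.continuousOn.sub (by fun_prop)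
    · rw [interior_Icc]
      intro y hy
      exact (((hloc y hy).differentiableAt (by norm_num)).sub (by fun_prop)).differentiableWithinAt
    · rw [interior_Icc]
      intro y hy
      refine DifferentiableAt.differentiableWithinAt ?_
      rw [(hev y hy).differentiableAt_iff]
      exact (hd1 y hy).sub (by fun_prop)
    · rw [interior_Icc]
      intro y hy
      rw [Function.iterate_succ, Function.iterate_one, Function.comp_apply, (hev y hy).deriv_eq]
      have h2 : deriv (fun y => deriv φ y - c * y) y = deriv (deriv φ) y - c := by
        have := ((hd1 y hy).hasDerivAt.sub ((hasDerivAt_id y).const_mul c)).deriv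
        refine Eq.trans ?_ (this.trans (by ring))
        rfl
      rw [h2]
      have h3 := hφ'' y (Set.Ioo_subset_Icc_self hy)
      rw [iteratedDerivWithin_eq_iteratedDeriv (uniqueDiffOn_Icc zero_lt_one) (hloc y hy)
        (Set.Ioo_subset_Icc_self hy), iteratedDeriv_succ, iteratedDeriv_one] at h3
      linarith
  have := mixed_difference_ge_of_convexOn hconv hu hv hx hxuv
  linarith

lemma abs_mixed_difference_ge_of_nonneg {φ : ℝ → ℝ} {c : ℝ} (hc : 0 < c)
    (hφ : ContDiffOn ℝ 2 φ (Set.Icc 0 1))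
    (hφ'' : ∀ x ∈ Set.Icc (0:ℝ) 1, c ≤ |iteratedDerivWithin 2 φ (Set.Icc 0 1) x|) {x u v : ℝ}
    (hu : 0 ≤ u) (hv : 0 ≤ v) (hx : x ∈ Set.Icc (0:ℝ) 1) (hxuv : x + u + v ∈ Set.Icc (0:ℝ) 1) :
    c * u * v ≤ |φ (x + u + v) - φ (x + u) - φ (x + v) + φ x| := by
  have hcont : ContinuousOn (iteratedDerivWithin 2 φ (Set.Icc 0 1)) (Set.Icc 0 1) :=
    hφ.continuousOn_iteratedDerivWithin (by norm_num) (uniqueDiffOn_Icc zero_lt_one)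
  have hne : ∀ y ∈ Set.Icc (0:ℝ) 1, iteratedDerivWithin 2 φ (Set.Icc 0 1) y ≠ 0 := by
    intro y hy h
    have := hφ'' y hy
    rw [h, abs_zero] at this
    linarith
  have hsign : (∀ y ∈ Set.Icc (0:ℝ) 1, 0 < iteratedDerivWithin 2 φ (Set.Icc 0 1) y) ∨
      (∀ y ∈ Set.Icc (0:ℝ) 1, iteratedDerivWithin 2 φ (Set.Icc 0 1) y < 0) := by
    by_contra! h
    obtain ⟨⟨y, hy, hy'⟩, z, hz, hz'⟩ := h
    obtain ⟨w, hw, hw0⟩ := (isPreconnected_Icc.intermediate_value hy hz hcont) ⟨hy', hz'⟩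
    exact hne w hw hw0
  rcases hsign with h | h
  · refine (mixed_difference_ge hφ (fun y hy => ?_) hu hv hx hxuv).trans (le_abs_self _)
    rw [← abs_of_pos (h y hy)]
    exact hφ'' y hy
  · have := mixed_difference_ge (φ := -φ) (c := c) hφ.neg (fun y hy => ?_) hu hv hx hxuv
    · refine this.trans ?_
      rw [← abs_neg]
      refine le_trans (le_of_eq ?_) (le_abs_self _)
      simp only [Pi.neg_apply]; ring
    · rw [iteratedDerivWithin_neg, ← abs_of_neg (h y hy)]
      exact hφ'' y hy

/-- Second differences of a function with `|φ''| ≥ c` are bounded below. -/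
lemma abs_mixed_difference_ge {φ : ℝ → ℝ} {c : ℝ} (hc : 0 < c)
    (hφ : ContDiffOn ℝ 2 φ (Set.Icc 0 1))
    (hφ'' : ∀ x ∈ Set.Icc (0:ℝ) 1, c ≤ |iteratedDerivWithin 2 φ (Set.Icc 0 1) x|) {x u v : ℝ}
    (hx : x ∈ Set.Icc (0:ℝ) 1) (hxu : x + u ∈ Set.Icc (0:ℝ) 1) (hxv : x + v ∈ Set.Icc (0:ℝ) 1)
    (hxuv : x + u + v ∈ Set.Icc (0:ℝ) 1) :
    c * |u| * |v| ≤ |φ (x + u + v) - φ (x + u) - φ (x + v) + φ x| := by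
  have key := @abs_mixed_difference_ge_of_nonneg φ c hc hφ hφ''
  rcases le_total 0 u with hu | hu <;> rcases le_total 0 v with hv | hv
  · rw [abs_of_nonneg hu, abs_of_nonneg hv]
    exact key hu hv hx hxuv
  · have := @key (x + v) u (-v) hu (by linarith) hxv (by convert hxu using 1; ring)
    rw [abs_of_nonneg hu, abs_of_nonpos hv]
    refine this.trans (le_of_eq ?_)
    rw [← abs_neg]
    ring_nf
  · have := @key (x + u) (-u) v (by linarith) hv hxu (by convert hxv using 1; ring)
    rw [abs_of_nonpos hu, abs_of_nonneg hv]
    refine this.trans (le_of_eq ?_)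
    rw [← abs_neg]
    ring_nf
  · have := @key (x + u + v) (-u) (-v) (by linarith) (by linarith) hxuv
      (by convert hx using 1; ring)
    rw [abs_of_nonpos hu, abs_of_nonpos hv]
    refine this.trans (le_of_eq ?_)
    ring_nf

lemma sum_inv_filter_dvd_le (L g : ℕ) (hg : 0 < g) :
    ∑ a ∈ Finset.Icc 1 L with g ∣ a, (1 / a : ℝ) ≤ (∑ a ∈ Finset.Icc 1 L, (1 / a : ℝ)) / g := by
  rw [Finset.sum_div]
  have hinj : Set.InjOn (fun a => a / g) ({a ∈ Finset.Icc 1 L | g ∣ a} : Finset ℕ) := by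
    intro a ha b hb hab
    simp only [Finset.coe_filter, Set.mem_ofPred_eq] at ha hb
    exact (Nat.div_left_inj ha.2 hb.2).1 hab
  calc ∑ a ∈ Finset.Icc 1 L with g ∣ a, (1 / a : ℝ)
      = ∑ a ∈ Finset.Icc 1 L with g ∣ a, (1 / (a / g : ℕ) : ℝ) / g := by
        refine Finset.sum_congr rfl fun a ha => ?_
        obtain ⟨h1, b, rfl⟩ := Finset.mem_filter.1 ha
        rw [Nat.mul_div_cancel_left _ hg]
        push_cast
        rw [div_div, mul_comm]
    _ = ∑ b ∈ ({a ∈ Finset.Icc 1 L | g ∣ a}).image (fun a => a / g), (1 / b : ℝ) / g := by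
        rw [Finset.sum_image hinj]
    _ ≤ _ := by
        refine Finset.sum_le_sum_of_subset_of_nonneg ?_ (fun _ _ _ => by positivity)
        intro b hb
        obtain ⟨a, ha, rfl⟩ := Finset.mem_image.1 hb
        obtain ⟨h1, b, rfl⟩ := Finset.mem_filter.1 ha
        rw [Nat.mul_div_cancel_left _ hg]
        rw [Finset.mem_Icc] at h1 ⊢
        refine ⟨Nat.pos_of_ne_zero fun h => by simp [h] at h1, ?_⟩
        exact (Nat.le_mul_of_pos_left b hg).trans h1.2

lemma sum_gcd_div_mul_le (L : ℕ) :
    ∑ p ∈ Finset.Icc 1 L ×ˢ Finset.Icc 1 L, (Nat.gcd p.1 p.2 : ℝ) / (p.1 * p.2) ≤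
      (∑ a ∈ Finset.Icc 1 L, (1 / a : ℝ)) ^ 3 := by
  set H : ℝ := ∑ a ∈ Finset.Icc 1 L, (1 / a : ℝ)
  have h1 : ∀ p ∈ Finset.Icc 1 L ×ˢ Finset.Icc 1 L, (Nat.gcd p.1 p.2 : ℝ) / (p.1 * p.2) ≤
      ∑ g ∈ Finset.Icc 1 L, (g : ℝ) *
        ((if g ∣ p.1 then (1 / p.1 : ℝ) else 0) * (if g ∣ p.2 then (1 / p.2 : ℝ) else 0)) := by
    intro p hp
    simp only [Finset.mem_product, Finset.mem_Icc] at hp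
    have hmem : Nat.gcd p.1 p.2 ∈ Finset.Icc 1 L := Finset.mem_Icc.2
      ⟨Nat.gcd_pos_of_pos_left _ (by omega), (Nat.gcd_le_left _ (by omega)).trans hp.1.2⟩
    refine le_trans (le_of_eq ?_) (Finset.single_le_sum (fun g _ => ?_) hmem)
    · rw [if_pos (Nat.gcd_dvd_left _ _), if_pos (Nat.gcd_dvd_right _ _)]
      rw [div_mul_div_comm, mul_one, mul_one_div]
    · positivity
  refine (Finset.sum_le_sum h1).trans ?_
  rw [Finset.sum_comm]
  calc _ = ∑ g ∈ Finset.Icc 1 L, (g : ℝ) * (∑ a ∈ Finset.Icc 1 L with g ∣ a, (1 / a : ℝ)) ^ 2 := by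
        refine Finset.sum_congr rfl fun g _ => ?_
        rw [← Finset.mul_sum, Finset.sum_filter, sq, Finset.sum_mul_sum, Finset.sum_product]
    _ ≤ ∑ g ∈ Finset.Icc 1 L, (g : ℝ) * (H / g) ^ 2 := by
        refine Finset.sum_le_sum fun g hg => ?_
        have := sum_inv_filter_dvd_le L g (Finset.mem_Icc.1 hg).1
        have h0 : 0 ≤ ∑ a ∈ Finset.Icc 1 L with g ∣ a, (1 / a : ℝ) :=
          Finset.sum_nonneg fun _ _ => by positivity
        gcongr
    _ = ∑ g ∈ Finset.Icc 1 L, H ^ 2 * (1 / g) := by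
        refine Finset.sum_congr rfl fun g hg => ?_
        have : (g : ℝ) ≠ 0 := by
          have := (Finset.mem_Icc.1 hg).1
          positivity
        field_simp
    _ = H ^ 3 := by rw [← Finset.mul_sum]; ring

lemma card_int_multiples_le (N b : ℕ) :
    ({h ∈ Finset.Icc (-(N : ℤ)) N | h ≠ 0 ∧ (b : ℤ) ∣ h}).card ≤ 2 * (N / b) := by
  have hsub : {h ∈ Finset.Icc (-(N : ℤ)) N | h ≠ 0 ∧ (b : ℤ) ∣ h} ⊆
      ({x ∈ Finset.Ioc 0 N | b ∣ x}).image (fun x : ℕ => (x : ℤ)) ∪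
      ({x ∈ Finset.Ioc 0 N | b ∣ x}).image (fun x : ℕ => -(x : ℤ)) := by
    intro h hh
    simp only [Finset.mem_filter, Finset.mem_Icc] at hh
    obtain ⟨⟨h1, h2⟩, h3, h4⟩ := hh
    have hmem : h.natAbs ∈ {x ∈ Finset.Ioc 0 N | b ∣ x} := by
      simp only [Finset.mem_filter, Finset.mem_Ioc]
      exact ⟨⟨by omega, by omega⟩, Int.natCast_dvd.1 h4⟩
    rcases le_total 0 h with h0 | h0
    · exact Finset.mem_union_left _ (Finset.mem_image.2 ⟨_, hmem, by omega⟩)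
    · exact Finset.mem_union_right _ (Finset.mem_image.2 ⟨_, hmem, by omega⟩)
  refine (Finset.card_le_card hsub).trans ((Finset.card_union_le _ _).trans ?_)
  have h1 := Finset.card_image_le (s := {x ∈ Finset.Ioc 0 N | b ∣ x}) (f := fun x : ℕ => (x : ℤ))
  have h2 := Finset.card_image_le (s := {x ∈ Finset.Ioc 0 N | b ∣ x}) (f := fun x : ℕ => -(x : ℤ))
  rw [Nat.Ioc_filter_dvd_card_eq_div] at h1 h2
  omega

/-- The nonzero solutions of `l * h = l' * h'` in a box. -/
noncomputable def proportionalPairs (N l l' : ℕ) : Finset (ℤ × ℤ) :=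
  {p ∈ Finset.Icc (-(N : ℤ)) N ×ˢ Finset.Icc (-(N : ℤ)) N | p.1 ≠ 0 ∧ (l : ℤ) * p.1 = l' * p.2}

lemma card_proportionalPairs_le_left (N : ℕ) {l l' : ℕ} (hl' : 0 < l') :
    ((proportionalPairs N l l').card : ℝ) ≤ 2 * N * Nat.gcd l l' / l' := by
  obtain ⟨a, b, hab, hla, hlb⟩ := Nat.exists_coprime l l'
  set g := Nat.gcd l l' with hg
  have hg0 : 0 < g := Nat.gcd_pos_of_pos_right _ hl'
  have hb0 : 0 < b := Nat.pos_of_ne_zero fun h => by simp [h] at hlb; omega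
  have hcard : (proportionalPairs N l l').card ≤ 2 * (N / b) := by
    refine le_trans (Finset.card_le_card_of_injOn Prod.fst ?_ ?_) (card_int_multiples_le N b)
    · intro p hp
      simp only [proportionalPairs, Finset.coe_filter, Finset.mem_product,
        Set.mem_ofPred_eq] at hp ⊢
      obtain ⟨⟨h1, h2⟩, h3, h4⟩ := hp
      refine ⟨h1, h3, ?_⟩
      have h5 : (a : ℤ) * p.1 = b * p.2 := by
        have : (g : ℤ) * (a * p.1) = g * (b * p.2) := by
          rw [hla, hlb] at h4
          push_cast at h4
          linarith
        exact mul_left_cancel₀ (by exact_mod_cast hg0.ne') this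
      exact (Nat.isCoprime_iff_coprime.2 hab.symm).dvd_of_dvd_mul_left ⟨p.2, h5⟩
    · intro p hp q hq hpq
      simp only [proportionalPairs, Finset.coe_filter, Finset.mem_product,
        Set.mem_ofPred_eq] at hp hq
      refine Prod.ext hpq ?_
      have : (l' : ℤ) * p.2 = l' * q.2 := by
        rw [← hp.2.2, ← hq.2.2, hpq]
      exact mul_left_cancel₀ (by exact_mod_cast hl'.ne') this
  calc ((proportionalPairs N l l').card : ℝ) ≤ 2 * ((N / b : ℕ) : ℝ) := by exact_mod_cast hcard
    _ ≤ 2 * ((N : ℝ) / b) := by gcongr; exact Nat.cast_div_le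
    _ = 2 * N * g / l' := by
        rw [hlb]
        push_cast
        field_simp

lemma card_proportionalPairs_le (N : ℕ) {l l' : ℕ} (hl : 0 < l) (hl' : 0 < l') :
    ((proportionalPairs N l l').card : ℝ) ≤ 2 * N * Nat.gcd l l' / max (l : ℝ) l' := by
  rcases le_total l l' with h | h
  · rw [max_eq_right (by exact_mod_cast h)]
    exact card_proportionalPairs_le_left N hl'
  · rw [max_eq_left (by exact_mod_cast h), Nat.gcd_comm]
    refine le_trans ?_ (card_proportionalPairs_le_left N hl)
    norm_cast
    refine Finset.card_le_card_of_injOn Prod.swap ?_ Prod.swap_injective.injOn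
    intro p hp
    simp only [proportionalPairs, Finset.coe_filter, Finset.mem_product,
        Set.mem_ofPred_eq] at hp ⊢
    obtain ⟨⟨h1, h2⟩, h3, h4⟩ := hp
    refine ⟨⟨h2, h1⟩, fun h0 => h3 ?_, h4.symm⟩
    rw [Prod.fst_swap] at h0
    rw [h0, mul_zero] at h4
    exact (mul_eq_zero.1 h4).resolve_left (by exact_mod_cast hl.ne')

lemma card_le_of_forall_abs_sub_le (s : Finset ℤ) {D : ℝ} (hD : 0 ≤ D)
    (h : ∀ x ∈ s, ∀ y ∈ s, |(x : ℝ) - y| ≤ D) : (s.card : ℝ) ≤ 1 + D := by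
  rcases s.eq_empty_or_nonempty with rfl | hs
  · simp; linarith
  · have hsub : s ⊆ Finset.Icc (s.min' hs) (s.min' hs + ⌊D⌋) := by
      intro x hx
      refine Finset.mem_Icc.2 ⟨s.min'_le x hx, ?_⟩
      have := (le_abs_self _).trans (h x hx _ (s.min'_mem hs))
      have : x - s.min' hs ≤ ⌊D⌋ := Int.le_floor.2 (by exact_mod_cast this)
      linarith
    have hc := Finset.card_le_card hsub
    rw [Int.card_Icc] at hc
    have h0 : 0 ≤ ⌊D⌋ := Int.floor_nonneg.2 hD
    have hc' : (s.card : ℤ) ≤ 1 + ⌊D⌋ := by omega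
    calc (s.card : ℝ) ≤ 1 + (⌊D⌋ : ℝ) := by exact_mod_cast hc'
      _ ≤ 1 + D := by gcongr; exact Int.floor_le D

/-- The frequencies `(l, j, k)`, `j ≠ k`, of the off-diagonal part of the pair correlation sum. -/
def offDiagIndex (N L : ℕ) : Finset (ℕ × ℕ × ℕ) :=
  Finset.Icc 1 L ×ˢ (Finset.Icc 1 N).offDiag

lemma mem_offDiagIndex {N L : ℕ} {x : ℕ × ℕ × ℕ} :
    x ∈ offDiagIndex N L ↔ (1 ≤ x.1 ∧ x.1 ≤ L) ∧ (1 ≤ x.2.1 ∧ x.2.1 ≤ N) ∧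
      (1 ≤ x.2.2 ∧ x.2.2 ≤ N) ∧ x.2.1 ≠ x.2.2 := by
  simp [offDiagIndex, Finset.mem_offDiag]

/-- The almost resonant pairs of frequencies. -/
noncomputable def resonantPairs (φ : ℝ → ℝ) (N L : ℕ) :
    Finset ((ℕ × ℕ × ℕ) × (ℕ × ℕ × ℕ)) :=
  open Classical in
  {q ∈ offDiagIndex N L ×ˢ offDiagIndex N L |
    |q.1.1 * N * (φ (q.1.2.1 / N) - φ (q.1.2.2 / N)) -
      q.2.1 * N * (φ (q.2.2.1 / N) - φ (q.2.2.2 / N))| < 1 ∧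
    (q.1.1 : ℤ) * ((q.1.2.1 : ℤ) - q.1.2.2) = q.2.1 * ((q.2.2.1 : ℤ) - q.2.2.2)}

lemma div_mem_unitInterval {N j : ℕ} (hj : j ≤ N) : (j : ℝ) / N ∈ Set.Icc (0:ℝ) 1 :=
  ⟨by positivity, div_le_one_of_le₀ (by exact_mod_cast hj) (by positivity)⟩

/-- Two resonant configurations sharing `(l, h, l', h', k')` have close base points. -/
lemma abs_base_sub_le {φ : ℝ → ℝ} {c : ℝ} (hc : 0 < c)
    (hφ : ContDiffOn ℝ 2 φ (Set.Icc 0 1))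
    (hφ'' : ∀ x ∈ Set.Icc (0:ℝ) 1, c ≤ |iteratedDerivWithin 2 φ (Set.Icc 0 1) x|)
    {N : ℕ} (hN : 0 < N) {l j₁ k₁ j₂ k₂ : ℕ} (hl : 0 < l) {h : ℤ} (hh : h ≠ 0) {z : ℝ}
    (hj₁ : j₁ ≤ N) (hk₁ : k₁ ≤ N) (hj₂ : j₂ ≤ N) (hk₂ : k₂ ≤ N)
    (e₁ : (j₁ : ℤ) - k₁ = h) (e₂ : (j₂ : ℤ) - k₂ = h)
    (h₁ : |l * N * (φ (j₁ / N) - φ (k₁ / N)) - z| < 1)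
    (h₂ : |l * N * (φ (j₂ / N) - φ (k₂ / N)) - z| < 1) :
    |(k₁ : ℝ) - k₂| ≤ 2 * N / c / (l * |(h : ℝ)|) := by
  have hN' : (0 : ℝ) < N := by exact_mod_cast hN
  have hl' : (0 : ℝ) < l := by exact_mod_cast hl
  have hh' : 0 < |(h : ℝ)| := abs_pos.2 (by exact_mod_cast hh)
  have r₁ : (j₁ : ℝ) = k₁ + h := by
    have : (j₁ : ℤ) = k₁ + h := by linarith
    exact_mod_cast this
  have r₂ : (j₂ : ℝ) = k₂ + h := by
    have : (j₂ : ℤ) = k₂ + h := by linarith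
    exact_mod_cast this
  have a1 : (k₂ : ℝ) / N + h / N = j₂ / N := by rw [r₂]; ring
  have a2 : (k₂ : ℝ) / N + ((k₁ : ℝ) - k₂) / N = k₁ / N := by ring
  have a3 : (k₂ : ℝ) / N + h / N + ((k₁ : ℝ) - k₂) / N = j₁ / N := by rw [r₁]; ring
  have key := abs_mixed_difference_ge hc hφ hφ'' (x := (k₂ : ℝ) / N) (u := h / N)
    (v := ((k₁ : ℝ) - k₂) / N) (div_mem_unitInterval hk₂)
    (by rw [a1]; exact div_mem_unitInterval hj₂)
    (by rw [a2]; exact div_mem_unitInterval hk₁) (by rw [a3]; exact div_mem_unitInterval hj₁)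
  rw [a3, a1, a2, abs_div, abs_div, abs_of_pos hN'] at key
  have h3 : |l * N * (φ (j₁ / N) - φ (j₂ / N) - φ (k₁ / N) + φ (k₂ / N))| < 2 := by
    have e : l * N * (φ (j₁ / N) - φ (j₂ / N) - φ (k₁ / N) + φ (k₂ / N)) =
      (l * N * (φ (j₁ / N) - φ (k₁ / N)) - z) - (l * N * (φ (j₂ / N) - φ (k₂ / N)) - z) := by ring
    rw [e]
    exact (abs_sub _ _).trans_lt (by linarith)
  rw [abs_mul, abs_of_pos (by positivity : (0:ℝ) < l * N)] at h3
  have h4 : l * N * (c * (|(h:ℝ)| / N) * (|(k₁ : ℝ) - k₂| / N)) ≤ 2 :=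
    (mul_le_mul_of_nonneg_left key (by positivity)).trans h3.le
  have h5 : l * N * (c * (|(h:ℝ)| / N) * (|(k₁ : ℝ) - k₂| / N)) =
      |(k₁ : ℝ) - k₂| * (c * l * |(h:ℝ)|) / N := by field_simp
  rw [h5, div_le_iff₀ hN'] at h4
  rw [div_div, le_div_iff₀ (by positivity)]
  linarith

lemma card_resonantPairs_le {φ : ℝ → ℝ} {c : ℝ} (hc : 0 < c)
    (hφ : ContDiffOn ℝ 2 φ (Set.Icc 0 1))
    (hφ'' : ∀ x ∈ Set.Icc (0:ℝ) 1, c ≤ |iteratedDerivWithin 2 φ (Set.Icc 0 1) x|)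
    {N : ℕ} (hN : 0 < N) (L : ℕ) :
    ((resonantPairs φ N L).card : ℝ) ≤
      2 * N ^ 2 * (L + 2 * N / c) * (∑ a ∈ Finset.Icc 1 L, (1 / a : ℝ)) ^ 3 := by
  classical
  let P : Finset ((ℕ × ℕ) × (ℤ × ℤ) × ℕ) :=
    (Finset.Icc 1 L ×ˢ Finset.Icc 1 L).biUnion fun l =>
      {l} ×ˢ (proportionalPairs N l.1 l.2 ×ˢ Finset.Icc 1 N)
  let F : (ℕ × ℕ × ℕ) × (ℕ × ℕ × ℕ) → (ℕ × ℕ) × (ℤ × ℤ) × ℕ := fun q =>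
    ((q.1.1, q.2.1), ((q.1.2.1 : ℤ) - q.1.2.2, (q.2.2.1 : ℤ) - q.2.2.2), q.2.2.2)
  have hmem : ∀ x, x ∈ P ↔ (x.1 ∈ Finset.Icc 1 L ×ˢ Finset.Icc 1 L) ∧
      x.2.1 ∈ proportionalPairs N x.1.1 x.1.2 ∧ x.2.2 ∈ Finset.Icc 1 N := by
    rintro ⟨l, h, k⟩
    simp only [P, Finset.mem_biUnion, Finset.mem_product, Finset.mem_singleton]
    constructor
    · rintro ⟨a, ha, rfl, hb⟩
      exact ⟨ha, hb⟩
    · rintro ⟨ha, hb⟩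
      exact ⟨l, ha, rfl, hb⟩
  have hmaps : ∀ q ∈ resonantPairs φ N L, F q ∈ P := by
    intro q hq
    simp only [resonantPairs, Finset.mem_filter, Finset.mem_product, mem_offDiagIndex] at hq
    rw [hmem]
    simp only [F, proportionalPairs, Finset.mem_filter, Finset.mem_product, Finset.mem_Icc]
    obtain ⟨⟨h1, h2⟩, -, h3⟩ := hq
    refine ⟨⟨h1.1, h2.1⟩, ⟨⟨⟨?_, ?_⟩, ?_, ?_⟩, ?_, h3⟩, h2.2.2.1⟩ <;> omega
  have hfib : ∀ x ∈ P, (({q ∈ resonantPairs φ N L | F q = x}).card : ℝ) ≤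
      (L + 2 * N / c) / max (x.1.1 : ℝ) x.1.2 := by
    intro x hx
    rw [hmem] at hx
    simp only [proportionalPairs, Finset.mem_filter, Finset.mem_product, Finset.mem_Icc] at hx
    obtain ⟨⟨hl1, hl2⟩, ⟨-, hh, hhh⟩, hk⟩ := hx
    have hl1' : (0:ℝ) < x.1.1 := by exact_mod_cast hl1.1
    have hhabs : 0 < |(x.2.1.1 : ℝ)| := abs_pos.2 (by exact_mod_cast hh)
    have hinj : Set.InjOn (fun q : (ℕ × ℕ × ℕ) × (ℕ × ℕ × ℕ) => (q.1.2.2 : ℤ))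
        ({q ∈ resonantPairs φ N L | F q = x} : Finset _) := by
      intro q hq r hr hqr
      simp only [Finset.coe_filter, Set.mem_ofPred_eq] at hq hr
      have e := hq.2.trans hr.2.symm
      simp only [F, Prod.mk.injEq] at e hqr
      obtain ⟨⟨e1, e2⟩, ⟨e3, e4⟩, e5⟩ := e
      ext <;> omega
    have hcard := card_le_of_forall_abs_sub_le
      (({q ∈ resonantPairs φ N L | F q = x}).image
        fun q : (ℕ × ℕ × ℕ) × (ℕ × ℕ × ℕ) => (q.1.2.2 : ℤ))
      (D := 2 * N / c / (x.1.1 * |(x.2.1.1 : ℝ)|)) (by positivity) (by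
        simp only [Finset.mem_image, Finset.mem_filter]
        rintro _ ⟨q, ⟨hq, hqx⟩, rfl⟩ _ ⟨r, ⟨hr, hrx⟩, rfl⟩
        simp only [resonantPairs, Finset.mem_filter, Finset.mem_product, mem_offDiagIndex] at hq hr
        obtain ⟨⟨hq1, hq2⟩, hq3, -⟩ := hq
        obtain ⟨⟨hr1, hr2⟩, hr3, -⟩ := hr
        have e := hqx.trans hrx.symm
        simp only [F, Prod.mk.injEq] at e
        obtain ⟨⟨e1, e2⟩, ⟨e3, e4⟩, e5⟩ := e
        have e6 : q.2.2.1 = r.2.2.1 := by omega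
        rw [← e1, ← e2, ← e5, ← e6] at hr3
        have f1 : q.1.1 = x.1.1 := by rw [← hqx]
        have f2 : (q.1.2.1 : ℤ) - q.1.2.2 = x.2.1.1 := by rw [← hqx]
        rw [← f1]
        exact_mod_cast abs_base_sub_le hc hφ hφ'' hN hq1.1.1 hh hq1.2.1.2 hq1.2.2.1.2 hr1.2.1.2
          hr1.2.2.1.2 f2 (e3.symm.trans f2) hq3 hr3)
    rw [Finset.card_image_of_injOn hinj] at hcard
    refine hcard.trans ?_
    have hmax : (0:ℝ) < max (x.1.1 : ℝ) x.1.2 := lt_max_of_lt_left hl1'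
    have hle : max (x.1.1 : ℝ) x.1.2 ≤ x.1.1 * |(x.2.1.1 : ℝ)| := by
      have h2ne : x.2.1.2 ≠ 0 := by
        intro h0
        rw [h0, mul_zero] at hhh
        rcases mul_eq_zero.1 hhh with h | h
        · have : x.1.1 = 0 := by exact_mod_cast h
          omega
        · exact hh h
      have heq : (x.1.1 : ℝ) * |(x.2.1.1 : ℝ)| = x.1.2 * |(x.2.1.2 : ℝ)| := by
        have : ((x.1.1 : ℤ) * x.2.1.1 : ℝ) = (x.1.2 : ℤ) * x.2.1.2 := by exact_mod_cast hhh
        have := congrArg abs this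
        simpa [abs_mul] using this
      have one1 : 1 ≤ |(x.2.1.1 : ℝ)| := by exact_mod_cast Int.one_le_abs hh
      have one2 : 1 ≤ |(x.2.1.2 : ℝ)| := by exact_mod_cast Int.one_le_abs h2ne
      refine max_le (le_mul_of_one_le_right hl1'.le one1) ?_
      rw [heq]
      exact le_mul_of_one_le_right (by positivity) one2
    have hmaxL : max (x.1.1 : ℝ) x.1.2 ≤ L :=
      max_le (by exact_mod_cast hl1.2) (by exact_mod_cast hl2.2)
    rw [add_div]
    gcongr
    rwa [one_le_div hmax]
  have hdisj : Set.PairwiseDisjoint (↑(Finset.Icc 1 L ×ˢ Finset.Icc 1 L))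
      (fun l : ℕ × ℕ => ({l} ×ˢ (proportionalPairs N l.1 l.2 ×ˢ Finset.Icc 1 N) :
        Finset ((ℕ × ℕ) × (ℤ × ℤ) × ℕ))) := by
    intro l _ l' _ hne
    rw [Function.onFun, Finset.disjoint_left]
    intro x hx hx'
    simp only [Finset.mem_product, Finset.mem_singleton] at hx hx'
    exact hne (hx.1.symm.trans hx'.1)
  calc ((resonantPairs φ N L).card : ℝ)
      = ∑ x ∈ P, (({q ∈ resonantPairs φ N L | F q = x}).card : ℝ) := by
        exact_mod_cast Finset.card_eq_sum_card_fiberwise hmaps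
    _ ≤ ∑ x ∈ P, (L + 2 * N / c) / max (x.1.1 : ℝ) x.1.2 := Finset.sum_le_sum hfib
    _ = ∑ l ∈ Finset.Icc 1 L ×ˢ Finset.Icc 1 L,
          (proportionalPairs N l.1 l.2).card * N * ((L + 2 * N / c) / max (l.1 : ℝ) l.2) := by
        rw [Finset.sum_biUnion hdisj]
        refine Finset.sum_congr rfl fun l _ => ?_
        rw [Finset.sum_product, Finset.sum_singleton]
        simp
    _ ≤ ∑ l ∈ Finset.Icc 1 L ×ˢ Finset.Icc 1 L,
          2 * N ^ 2 * (L + 2 * N / c) * ((Nat.gcd l.1 l.2 : ℝ) / (l.1 * l.2)) := by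
        refine Finset.sum_le_sum fun l hl => ?_
        simp only [Finset.mem_product, Finset.mem_Icc] at hl
        have h1 : (0:ℝ) < l.1 := by exact_mod_cast hl.1.1
        have h2 : (0:ℝ) < l.2 := by exact_mod_cast hl.2.1
        have hmax : (0:ℝ) < max (l.1 : ℝ) l.2 := lt_max_of_lt_left h1
        calc _ ≤ (2 * N * Nat.gcd l.1 l.2 / max (l.1 : ℝ) l.2) * N *
              ((L + 2 * N / c) / max (l.1 : ℝ) l.2) := by
              gcongr
              exact card_proportionalPairs_le N hl.1.1 hl.2.1
          _ = 2 * N ^ 2 * (L + 2 * N / c) *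
              ((Nat.gcd l.1 l.2 : ℝ) / (max (l.1 : ℝ) l.2 * max (l.1 : ℝ) l.2)) := by
              field_simp
          _ ≤ _ := by
              gcongr
              exacts [le_max_left _ _, le_max_right _ _]
    _ ≤ _ := by
        rw [← Finset.mul_sum]
        gcongr
        exact sum_gcd_div_mul_le L

/-- The exponential sum `∑ⱼ exp (i t ℓ N (α φ(j/N) + β j/N))`. -/
noncomputable def phaseSum (φ : ℝ → ℝ) (t : ℝ) (N : ℕ) (ℓ : ℤ) (p : ℝ × ℝ) : ℂ :=
  ∑ j ∈ Finset.Icc 1 N, Complex.exp (Complex.I *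
    ((t * ℓ * N * (p.1 * φ ((j : ℝ) / N) + p.2 * ((j : ℝ) / N)) : ℝ) : ℂ))

/-- The off-diagonal part, over `1 ≤ ℓ ≤ L`, of the pair correlation functional. -/
noncomputable def offDiagSum (φ : ℝ → ℝ) (t : ℝ) (u : ℝ → ℂ) (N L : ℕ) (p : ℝ × ℝ) : ℂ :=
  ((1 / (N : ℝ) ^ 2 : ℝ) : ℂ) * ∑ ℓ ∈ Finset.Icc 1 L,
    u (2 * π * ℓ / N) * ((‖phaseSum φ t N ℓ p‖ ^ 2 - N : ℝ) : ℂ)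

lemma norm_phaseSum_sq_sub (φ : ℝ → ℝ) (t : ℝ) (N : ℕ) (ℓ : ℤ) (p : ℝ × ℝ) :
    ((‖phaseSum φ t N ℓ p‖ ^ 2 - N : ℝ) : ℂ) = ∑ x ∈ (Finset.Icc 1 N).offDiag,
      Complex.exp (Complex.I * (t * (ℓ * N * (φ (x.1 / N) - φ (x.2 / N))) * p.1 +
        t * (ℓ * N * (x.1 / N - x.2 / N)) * p.2 : ℝ)) := by
  have hexp : ∀ j k : ℕ, Complex.exp (Complex.I *
      ((t * ℓ * N * (p.1 * φ ((j : ℝ) / N) + p.2 * ((j : ℝ) / N)) : ℝ) : ℂ)) *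
      (starRingEnd ℂ) (Complex.exp (Complex.I *
      ((t * ℓ * N * (p.1 * φ ((k : ℝ) / N) + p.2 * ((k : ℝ) / N)) : ℝ) : ℂ))) =
      Complex.exp (Complex.I * (t * (ℓ * N * (φ (j / N) - φ (k / N))) * p.1 +
        t * (ℓ * N * (j / N - k / N)) * p.2 : ℝ)) := by
    intro j k
    rw [← Complex.exp_conj, map_mul, Complex.conj_I, Complex.conj_ofReal, ← Complex.exp_add]
    congr 1
    push_cast
    ring
  have hdiag : ∑ x ∈ (Finset.Icc 1 N).diag,
      Complex.exp (Complex.I * (t * (ℓ * N * (φ (x.1 / N) - φ (x.2 / N))) * p.1 +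
        t * (ℓ * N * (x.1 / N - x.2 / N)) * p.2 : ℝ)) = N := by
    rw [Finset.sum_diag]
    simp
  rw [Complex.ofReal_sub, Complex.ofReal_pow, ← Complex.mul_conj', Complex.ofReal_natCast,
    sub_eq_iff_eq_add', ← hdiag, ← Finset.sum_union (Finset.disjoint_diag_offDiag _),
    Finset.diag_union_offDiag, phaseSum, map_sum, Finset.sum_mul_sum, Finset.sum_product]
  exact Finset.sum_congr rfl fun j _ => Finset.sum_congr rfl fun k _ => hexp j k

lemma offDiagSum_eq (φ : ℝ → ℝ) (t : ℝ) (u : ℝ → ℂ) (N L : ℕ) (p : ℝ × ℝ) :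
    offDiagSum φ t u N L p = ∑ i ∈ offDiagIndex N L,
      (((1 / (N : ℝ) ^ 2 : ℝ) : ℂ) * u (2 * π * i.1 / N)) * Complex.exp (Complex.I *
        ((t * (i.1 * N * (φ (i.2.1 / N) - φ (i.2.2 / N)))) * p.1 +
          (t * (i.1 * N * (i.2.1 / N - i.2.2 / N))) * p.2 : ℝ)) := by
  rw [offDiagSum, offDiagIndex, Finset.sum_product, Finset.mul_sum]
  refine Finset.sum_congr rfl fun ℓ _ => ?_
  rw [norm_phaseSum_sq_sub, ← mul_assoc, Finset.mul_sum]
  simp only [Int.cast_natCast]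

lemma integral_weight_norm_sq_offDiagSum_le {φ : ℝ → ℝ} {c t : ℝ} (hc : 0 < c) (ht : t ≠ 0)
    (hφ : ContDiffOn ℝ 2 φ (Set.Icc 0 1))
    (hφ'' : ∀ x ∈ Set.Icc (0:ℝ) 1, c ≤ |iteratedDerivWithin 2 φ (Set.Icc 0 1) x|)
    {k : ℝ → ℝ} (hk : Integrable k) (hk0 : ∀ x, 0 ≤ k x)
    (hkδ : ∀ ξ : ℝ, |t| ≤ |ξ| → ∫ x, (k x : ℂ) * Complex.exp (Complex.I * (ξ * x : ℝ)) = 0)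
    {u : ℝ → ℂ} {B : ℝ} {R : ℕ} (hu : ∀ x ∈ Set.Icc 0 (2 * π * R), ‖u x‖ ≤ B)
    {N : ℕ} (hN : 0 < N) :
    Integrable (fun p : ℝ × ℝ => k p.1 * k p.2 * ‖offDiagSum φ t u N (R * N) p‖ ^ 2) ∧
    ∫ p : ℝ × ℝ, k p.1 * k p.2 * ‖offDiagSum φ t u N (R * N) p‖ ^ 2 ≤
      2 * B ^ 2 * (∫ x, k x) ^ 2 * (R + 2 / c) *
        ((∑ a ∈ Finset.Icc 1 (R * N), (1 / a : ℝ)) ^ 3 / N) := by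
  have hN' : (0:ℝ) < N := by exact_mod_cast hN
  have ht' : 0 < |t| := abs_pos.2 ht
  have key := integral_weight_norm_sq_expSum_le (offDiagIndex N (R * N))
    (fun i => ((1 / (N : ℝ) ^ 2 : ℝ) : ℂ) * u (2 * π * i.1 / N))
    (fun i => t * (i.1 * N * (φ (i.2.1 / N) - φ (i.2.2 / N))))
    (fun i => t * (i.1 * N * (i.2.1 / N - i.2.2 / N))) (B := 1 / (N : ℝ) ^ 2 * B) hk hk0 hkδ (by
      intro i hi
      rw [mem_offDiagIndex] at hi
      rw [norm_mul, Complex.norm_real, Real.norm_of_nonneg (by positivity)]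
      refine mul_le_mul_of_nonneg_left (hu _ ⟨by positivity, ?_⟩) (by positivity)
      rw [div_le_iff₀ hN', mul_assoc (2 * π)]
      have : (i.1 : ℝ) ≤ R * N := by exact_mod_cast hi.1.2
      gcongr)
  simp only [← offDiagSum_eq] at key
  refine ⟨key.1, key.2.trans ?_⟩
  have hsub : ({q ∈ offDiagIndex N (R * N) ×ˢ offDiagIndex N (R * N) |
      |t * (q.1.1 * N * (φ (q.1.2.1 / N) - φ (q.1.2.2 / N))) -
        t * (q.2.1 * N * (φ (q.2.2.1 / N) - φ (q.2.2.2 / N)))| < |t| ∧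
      |t * (q.1.1 * N * ((q.1.2.1 : ℝ) / N - q.1.2.2 / N)) -
        t * (q.2.1 * N * ((q.2.2.1 : ℝ) / N - q.2.2.2 / N))| < |t|} : Finset _) ⊆
      resonantPairs φ N (R * N) := by
    intro q hq
    simp only [resonantPairs, Finset.mem_filter] at hq ⊢
    obtain ⟨h1, h2, h3⟩ := hq
    rw [← mul_sub, abs_mul, mul_lt_iff_lt_one_right ht'] at h2 h3
    refine ⟨h1, h2, ?_⟩
    have h4 : |((q.1.1 : ℤ) * ((q.1.2.1 : ℤ) - q.1.2.2) -
        q.2.1 * ((q.2.2.1 : ℤ) - q.2.2.2) : ℤ)| < 1 := by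
      have : (q.1.1 * N * ((q.1.2.1 : ℝ) / N - q.1.2.2 / N)) -
          (q.2.1 * N * ((q.2.2.1 : ℝ) / N - q.2.2.2 / N)) =
          (((q.1.1 : ℤ) * ((q.1.2.1 : ℤ) - q.1.2.2) -
            q.2.1 * ((q.2.2.1 : ℤ) - q.2.2.2) : ℤ) : ℝ) := by
        push_cast
        field_simp
      rw [this] at h3
      exact_mod_cast h3
    exact sub_eq_zero.1 (Int.abs_lt_one_iff.1 h4)
  have hcard := (Nat.cast_le (α := ℝ).2 (Finset.card_le_card hsub)).trans
    (card_resonantPairs_le hc hφ hφ'' hN (R * N))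
  refine (mul_le_mul_of_nonneg_left hcard (by positivity)).trans (le_of_eq ?_)
  push_cast
  field_simp

lemma ae_tendsto_zero_of_summable_integral {α : Type*} [MeasurableSpace α] {μ : Measure α}
    {F : ℕ → α → ℝ} (h0 : ∀ n x, 0 ≤ F n x) (hI : ∀ n, Integrable (F n) μ)
    (hs : Summable fun n => ∫ x, F n x ∂μ) :
    ∀ᵐ x ∂μ, Tendsto (fun n => F n x) atTop (𝓝 0) := by
  have hmeas : ∀ n, AEMeasurable (fun x => ENNReal.ofReal (F n x)) μ :=
    fun n => (hI n).aemeasurable.ennreal_ofReal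
  have hfin : ∫⁻ x, ∑' n, ENNReal.ofReal (F n x) ∂μ ≠ ⊤ := by
    rw [lintegral_tsum hmeas]
    simp_rw [← ofReal_integral_eq_lintegral_ofReal (hI _) (Eventually.of_forall (h0 _))]
    exact hs.tsum_ofReal_ne_top
  filter_upwards [ae_lt_top' (AEMeasurable.tsum hmeas) hfin] with x hx
  have := ENNReal.tendsto_atTop_zero_of_tsum_ne_top hx.ne
  rw [← ENNReal.tendsto_toReal_iff (by simp) (by simp)] at this
  simpa [ENNReal.toReal_ofReal, h0] using this

lemma summable_inv_mul_log_sq : Summable fun n : ℕ => (1 : ℝ) / (n * Real.log n ^ 2) := by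
  rw [← summable_condensed_iff_of_eventually_nonneg
    (f := fun n : ℕ => (1 : ℝ) / (n * Real.log n ^ 2))]
  · have h := (Real.summable_one_div_nat_pow.2 one_lt_two).mul_left (1 / Real.log 2 ^ 2)
    refine h.congr fun k => ?_
    push_cast
    rw [Real.log_pow]
    field_simp
  · exact Eventually.of_forall fun n => by
      simp only [Pi.zero_apply]
      positivity
  · filter_upwards [eventually_ge_atTop 2] with n hn
    have h1 : (2:ℝ) ≤ n := by exact_mod_cast hn
    have h2 : 0 < Real.log n := Real.log_pos (by linarith)
    have h3 : Real.log n ≤ Real.log (n + 1 : ℕ) :=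
      Real.log_le_log (by linarith) (by push_cast; linarith)
    have h4 : (n : ℝ) ≤ (n + 1 : ℕ) := by push_cast; linarith
    gcongr

/-- The subsequence `⌊m (log m)⁵⌋`. -/
noncomputable def sparseSeq (m : ℕ) : ℕ := Nat.floor ((m : ℝ) * Real.log m ^ 5)

lemma sum_one_div_le_one_add_log (n : ℕ) :
    ∑ a ∈ Finset.Icc 1 n, (1 / a : ℝ) ≤ 1 + Real.log n := by
  have := harmonic_le_one_add_log n
  rw [harmonic_eq_sum_Icc] at this
  push_cast at this
  simpa using this

lemma eventually_sparseSeq_ge : ∀ᶠ m : ℕ in atTop,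
    (m : ℝ) * Real.log m ^ 5 / 2 ≤ sparseSeq m := by
  filter_upwards [eventually_ge_atTop 2,
    (Real.tendsto_log_atTop.comp tendsto_natCast_atTop_atTop).eventually_ge_atTop 1] with m hm hlog
  simp only [Function.comp_apply] at hlog
  have hm' : (2:ℝ) ≤ m := by exact_mod_cast hm
  have h1 : (1:ℝ) ≤ Real.log m ^ 5 := one_le_pow₀ hlog
  have h2 : 2 ≤ (m : ℝ) * Real.log m ^ 5 := by nlinarith
  have h3 := (Nat.lt_floor_add_one ((m : ℝ) * Real.log m ^ 5)).le
  rw [sparseSeq]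
  linarith

lemma tendsto_sparseSeq : Tendsto sparseSeq atTop atTop := by
  rw [← tendsto_natCast_atTop_iff (R := ℝ)]
  refine tendsto_atTop_mono' _ eventually_sparseSeq_ge ?_
  refine Tendsto.atTop_div_const (by norm_num) (tendsto_natCast_atTop_atTop.atTop_mul_atTop₀ ?_)
  exact (tendsto_pow_atTop (by norm_num)).comp
    (Real.tendsto_log_atTop.comp tendsto_natCast_atTop_atTop)

lemma summable_variance_bound (R : ℕ) : Summable fun m : ℕ =>
    (∑ a ∈ Finset.Icc 1 (R * sparseSeq m), (1 / a : ℝ)) ^ 3 / sparseSeq m := by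
  refine summable_of_isBigO_nat (summable_inv_mul_log_sq.mul_left 128) ?_
  refine Asymptotics.IsBigO.of_bound 1 ?_
  have hlit : ∀ᶠ m : ℕ in atTop, Real.log m ^ 5 ≤ m := by
    have := (isLittleO_pow_log_id_atTop (n := 5)).bound (c := 1) one_pos
    filter_upwards [tendsto_natCast_atTop_atTop.eventually this] with m hm
    simp only [id, one_mul, Real.norm_eq_abs, Nat.abs_cast] at hm
    exact (le_abs_self _).trans hm
  filter_upwards [hlit, eventually_sparseSeq_ge, eventually_ge_atTop 2, eventually_ge_atTop R,
    (Real.tendsto_log_atTop.comp tendsto_natCast_atTop_atTop).eventually_ge_atTop 1,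
    tendsto_sparseSeq.eventually_ge_atTop 1]
    with m h5 hge hm2 hmR hlog hs1
  simp only [Function.comp_apply] at hlog
  have hm' : (2:ℝ) ≤ m := by exact_mod_cast hm2
  have hmR' : (R:ℝ) ≤ m := by exact_mod_cast hmR
  have hs : (sparseSeq m : ℝ) ≤ m * m := by
    refine (Nat.floor_le (by positivity)).trans ?_
    gcongr
  have hs0 : (0:ℝ) < sparseSeq m := by exact_mod_cast hs1
  have hH0 : 0 ≤ ∑ a ∈ Finset.Icc 1 (R * sparseSeq m), (1 / a : ℝ) :=
    Finset.sum_nonneg fun _ _ => by positivity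
  have hH : ∑ a ∈ Finset.Icc 1 (R * sparseSeq m), (1 / a : ℝ) ≤ 4 * Real.log m := by
    refine (sum_one_div_le_one_add_log _).trans ?_
    rcases Nat.eq_zero_or_pos R with rfl | hR
    · simp; linarith
    · have hR' : (0:ℝ) < R := by exact_mod_cast hR
      have : Real.log (R * sparseSeq m : ℕ) ≤ Real.log ((m:ℝ) ^ 3) := by
        apply Real.log_le_log
        · push_cast; positivity
        · push_cast
          calc (R : ℝ) * sparseSeq m ≤ m * (m * m) := by gcongr
            _ = (m:ℝ) ^ 3 := by ring
      rw [Real.log_pow] at this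
      push_cast at this ⊢
      linarith
  rw [Real.norm_of_nonneg (by positivity), Real.norm_of_nonneg (by positivity), one_mul]
  calc _ ≤ (4 * Real.log m) ^ 3 / (m * Real.log m ^ 5 / 2) := by
        have : 0 < Real.log m := by linarith
        gcongr
    _ = 128 * (1 / (m * Real.log m ^ 2)) := by
        field_simp
        norm_num

lemma ae_tendsto_offDiagSum {φ : ℝ → ℝ} {c t T : ℝ} (hc : 0 < c) (ht : t ≠ 0) (hT : 0 < T)
    (hφ : ContDiffOn ℝ 2 φ (Set.Icc 0 1))
    (hφ'' : ∀ x ∈ Set.Icc (0:ℝ) 1, c ≤ |iteratedDerivWithin 2 φ (Set.Icc 0 1) x|)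
    {u : ℝ → ℂ} (hu : Continuous u) (R : ℕ) :
    ∀ᵐ p : ℝ × ℝ, p ∈ Set.Icc (-T) T ×ˢ Set.Icc (-T) T →
      Tendsto (fun m => offDiagSum φ t u (sparseSeq m) (R * sparseSeq m) p) atTop (𝓝 0) := by
  obtain ⟨k, hk, hk0, hk1, hkδ⟩ := exists_bandlimited_majorant T |t| hT (abs_pos.2 ht)
  obtain ⟨B, hB⟩ := (isCompact_Icc (a := (0:ℝ)) (b := 2 * π * R)).exists_bound_of_continuousOn
    hu.continuousOn
  have key : ∀ N : ℕ,
      Integrable (fun p : ℝ × ℝ => k p.1 * k p.2 * ‖offDiagSum φ t u N (R * N) p‖ ^ 2) ∧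
      ∫ p : ℝ × ℝ, k p.1 * k p.2 * ‖offDiagSum φ t u N (R * N) p‖ ^ 2 ≤
        2 * B ^ 2 * (∫ x, k x) ^ 2 * (R + 2 / c) *
          ((∑ a ∈ Finset.Icc 1 (R * N), (1 / a : ℝ)) ^ 3 / N) := by
    intro N
    rcases Nat.eq_zero_or_pos N with rfl | hN
    · simp [offDiagSum]
    · exact integral_weight_norm_sq_offDiagSum_le hc ht hφ hφ'' hk hk0 hkδ hB hN
  have h0 : ∀ (m : ℕ) (p : ℝ × ℝ),
      0 ≤ k p.1 * k p.2 * ‖offDiagSum φ t u (sparseSeq m) (R * sparseSeq m) p‖ ^ 2 :=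
    fun m p => mul_nonneg (mul_nonneg (hk0 _) (hk0 _)) (sq_nonneg _)
  have hsum := Summable.of_nonneg_of_le (fun m => integral_nonneg (h0 m))
    (fun m => (key (sparseSeq m)).2) ((summable_variance_bound R).mul_left _)
  filter_upwards [ae_tendsto_zero_of_summable_integral h0 (fun m => (key _).1) hsum]
    with p hp hpT
  have hsq : Tendsto (fun m => ‖offDiagSum φ t u (sparseSeq m) (R * sparseSeq m) p‖ ^ 2)
      atTop (𝓝 0) := by
    refine squeeze_zero (fun _ => sq_nonneg _) (fun m => ?_) hp
    exact le_mul_of_one_le_left (sq_nonneg _)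
      (one_le_mul_of_one_le_of_one_le (hk1 _ hpT.1) (hk1 _ hpT.2))
  have := hsq.sqrt
  simp only [Real.sqrt_sq (norm_nonneg _), Real.sqrt_zero] at this
  exact tendsto_zero_iff_norm_tendsto_zero.2 this

lemma norm_offDiagSum_le {u v : ℝ → ℂ} {ε : ℝ} {R : ℕ} (hε : 0 ≤ ε)
    (h : ∀ x ∈ Set.Icc 0 (2 * π * R), ‖u x - v x‖ ≤ ε)
    (φ : ℝ → ℝ) (t : ℝ) (N : ℕ) (p : ℝ × ℝ) :
    ‖offDiagSum φ t u N (R * N) p‖ ≤ ‖offDiagSum φ t v N (R * N) p‖ +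
      ε * (‖offDiagSum φ t (fun _ => 1) N (R * N) p‖ + 2 * R) := by
  rcases Nat.eq_zero_or_pos N with rfl | hN
  · simp only [offDiagSum, Nat.cast_zero]
    simp
    positivity
  have hN' : (0:ℝ) < N := by exact_mod_cast hN
  have hdiff : offDiagSum φ t u N (R * N) p - offDiagSum φ t v N (R * N) p =
      ((1 / (N : ℝ) ^ 2 : ℝ) : ℂ) * ∑ ℓ ∈ Finset.Icc 1 (R * N),
        (u (2 * π * ℓ / N) - v (2 * π * ℓ / N)) * ((‖phaseSum φ t N ℓ p‖ ^ 2 - N : ℝ) : ℂ) := by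
    simp only [offDiagSum, sub_mul, Finset.sum_sub_distrib, mul_sub]
  have hone : 1 / (N : ℝ) ^ 2 * ∑ ℓ ∈ Finset.Icc 1 (R * N), (‖phaseSum φ t N ℓ p‖ ^ 2 - N) ≤
      ‖offDiagSum φ t (fun _ => 1) N (R * N) p‖ := by
    have : offDiagSum φ t (fun _ => 1) N (R * N) p = ((1 / (N : ℝ) ^ 2 *
        ∑ ℓ ∈ Finset.Icc 1 (R * N), (‖phaseSum φ t N ℓ p‖ ^ 2 - N) : ℝ) : ℂ) := by
      simp [offDiagSum]
    rw [this, Complex.norm_real]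
    exact Real.le_norm_self _
  have hterm : ∀ ℓ ∈ Finset.Icc 1 (R * N),
      ‖(u (2 * π * ℓ / N) - v (2 * π * ℓ / N)) * ((‖phaseSum φ t N ℓ p‖ ^ 2 - N : ℝ) : ℂ)‖ ≤
        ε * ((‖phaseSum φ t N ℓ p‖ ^ 2 - N) + 2 * N) := by
    intro ℓ hℓ
    rw [norm_mul, Complex.norm_real, Real.norm_eq_abs]
    refine mul_le_mul (h _ ⟨by positivity, ?_⟩) ?_ (abs_nonneg _) hε
    · rw [div_le_iff₀ hN', mul_assoc]
      have : (ℓ : ℝ) ≤ R * N := by exact_mod_cast (Finset.mem_Icc.1 hℓ).2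
      nlinarith [Real.pi_pos]
    · rw [abs_le]
      constructor <;> nlinarith [sq_nonneg ‖phaseSum φ t N ℓ p‖]
  have hbound : ‖offDiagSum φ t u N (R * N) p - offDiagSum φ t v N (R * N) p‖ ≤
      ε * (‖offDiagSum φ t (fun _ => 1) N (R * N) p‖ + 2 * R) := by
    rw [hdiff, norm_mul, Complex.norm_real, Real.norm_of_nonneg (by positivity)]
    calc _ ≤ 1 / (N : ℝ) ^ 2 * ∑ ℓ ∈ Finset.Icc 1 (R * N),
          ε * ((‖phaseSum φ t N ℓ p‖ ^ 2 - N) + 2 * N) := by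
          gcongr
          exact (norm_sum_le _ _).trans (Finset.sum_le_sum hterm)
      _ = ε * (1 / (N : ℝ) ^ 2 * ∑ ℓ ∈ Finset.Icc 1 (R * N), (‖phaseSum φ t N ℓ p‖ ^ 2 - N)
          + 2 * R) := by
          rw [← Finset.mul_sum, Finset.sum_add_distrib, Finset.sum_const, Nat.card_Icc,
            Nat.add_sub_cancel, nsmul_eq_mul]
          push_cast
          field_simp
      _ ≤ _ := by gcongr
  calc _ = ‖offDiagSum φ t v N (R * N) p +
        (offDiagSum φ t u N (R * N) p - offDiagSum φ t v N (R * N) p)‖ := by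
        rw [add_sub_cancel]
    _ ≤ _ := (norm_add_le _ _).trans (by gcongr)

lemma exists_denseSeq_norm_sub_le {u : ℝ → ℂ} (hu : Continuous u) (b : ℝ) {ε : ℝ}
    (hε : 0 < ε) : ∃ n, ∀ x ∈ Set.Icc 0 b,
      ‖u x - TopologicalSpace.denseSeq C(ℝ, ℂ) n x‖ ≤ ε := by
  have hopen : IsOpen {g : C(ℝ, ℂ) |
      Set.MapsTo (⇑((⟨u, hu⟩ : C(ℝ, ℂ)) - g)) (Set.Icc 0 b) (Metric.ball 0 ε)} :=
    (ContinuousMap.isOpen_setOfPred_mapsTo isCompact_Icc Metric.isOpen_ball).preimage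
      (continuous_const.sub continuous_id)
  obtain ⟨n, hn⟩ := (TopologicalSpace.denseRange_denseSeq C(ℝ, ℂ)).exists_mem_open hopen
    ⟨⟨u, hu⟩, fun x _ => by simp [hε]⟩
  refine ⟨n, fun x hx => ?_⟩
  have := hn hx
  rw [mem_ball_zero_iff] at this
  exact this.le

lemma ae_forall_tendsto_offDiagSum {φ : ℝ → ℝ} {c t T : ℝ} (hc : 0 < c) (ht : t ≠ 0)
    (hT : 0 < T) (hφ : ContDiffOn ℝ 2 φ (Set.Icc 0 1))
    (hφ'' : ∀ x ∈ Set.Icc (0:ℝ) 1, c ≤ |iteratedDerivWithin 2 φ (Set.Icc 0 1) x|) :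
    ∀ᵐ p : ℝ × ℝ, p ∈ Set.Icc (-T) T ×ˢ Set.Icc (-T) T →
      ∀ (u : ℝ → ℂ), Continuous u → ∀ R : ℕ,
      Tendsto (fun m => offDiagSum φ t u (sparseSeq m) (R * sparseSeq m) p) atTop (𝓝 0) := by
  have hone : ∀ᵐ p : ℝ × ℝ, ∀ R : ℕ, p ∈ Set.Icc (-T) T ×ˢ Set.Icc (-T) T →
      Tendsto (fun m => offDiagSum φ t (fun _ => 1) (sparseSeq m) (R * sparseSeq m) p)
        atTop (𝓝 0) :=
    ae_all_iff.2 fun R => ae_tendsto_offDiagSum hc ht hT hφ hφ'' continuous_const R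
  have hdense : ∀ᵐ p : ℝ × ℝ, ∀ (R n : ℕ), p ∈ Set.Icc (-T) T ×ˢ Set.Icc (-T) T →
      Tendsto (fun m => offDiagSum φ t (TopologicalSpace.denseSeq C(ℝ, ℂ) n) (sparseSeq m)
        (R * sparseSeq m) p) atTop (𝓝 0) :=
    ae_all_iff.2 fun R => ae_all_iff.2 fun n =>
      ae_tendsto_offDiagSum hc ht hT hφ hφ'' (map_continuous _) R
  filter_upwards [hone, hdense] with p hp1 hpd hpT u hu R
  rw [tendsto_zero_iff_norm_tendsto_zero, Metric.tendsto_atTop']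
  intro ε hε
  have hη : 0 < ε / (2 * (2 + 2 * R)) := by positivity
  obtain ⟨n, hn⟩ := exists_denseSeq_norm_sub_le hu (2 * π * R) hη
  have e1 := (tendsto_zero_iff_norm_tendsto_zero.1 (hp1 R hpT)).eventually_lt_const one_pos
  have e2 := (tendsto_zero_iff_norm_tendsto_zero.1 (hpd R n hpT)).eventually_lt_const
    (half_pos hε)
  obtain ⟨M, hM⟩ := eventually_atTop.1 (e1.and e2)
  refine ⟨M, fun m hm => ?_⟩
  obtain ⟨h1, h2⟩ := hM m hm.le
  rw [dist_zero_right, norm_norm]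
  refine (norm_offDiagSum_le hη.le hn φ t (sparseSeq m) p).trans_lt ?_
  have : ε / (2 * (2 + 2 * R)) * (‖offDiagSum φ t (fun _ => 1) (sparseSeq m)
      (R * sparseSeq m) p‖ + 2 * R) ≤ ε / (2 * (2 + 2 * R)) * (2 + 2 * R) := by
    gcongr
    linarith
  have h3 : ε / (2 * (2 + 2 * R)) * (2 + 2 * R) = ε / 2 := by field_simp
  linarith

lemma FT_eq_fourier (f : SchwartzMap ℝ ℝ) (ξ : ℝ) :
    FT f ξ = FourierTransform.fourier (f.postcompCLM Complex.ofRealCLM) (ξ / (2 * π)) := by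
  rw [SchwartzMap.fourier_coe, Real.fourier_real_eq_integral_exp_smul, FT]
  refine integral_congr_ae (Eventually.of_forall fun x => ?_)
  simp only [SchwartzMap.postcompCLM_apply, Complex.ofRealCLM_apply, smul_eq_mul]
  rw [mul_comm]
  congr 2
  push_cast
  field_simp

lemma continuous_FT (f : SchwartzMap ℝ ℝ) : Continuous (FT f) := by
  simp_rw [funext (FT_eq_fourier f)]
  exact (SchwartzMap.continuous _).comp (continuous_id.div_const _)

/-- Poisson summation for dilates of a Schwartz function. -/
lemma tsum_FT_div (f : SchwartzMap ℝ ℝ) {N : ℕ} (hN : 0 < N) :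
    (N : ℂ)⁻¹ * ∑' ℓ : ℤ, FT f (2 * π * ℓ / N) = ∑' k : ℤ, (f (k * N) : ℂ) := by
  have hN' : (N : ℝ) ≠ 0 := by exact_mod_cast hN.ne'
  set g : SchwartzMap ℝ ℂ := f.postcompCLM Complex.ofRealCLM with hg
  set h : SchwartzMap ℝ ℂ := SchwartzMap.compCLMOfContinuousLinearEquiv ℂ
    (ContinuousLinearEquiv.unitsEquivAut ℝ (Units.mk0 (N : ℝ) hN')) g with hh
  have hval : ∀ x, h x = (f (x * N) : ℂ) := fun x => rfl
  have hP := SchwartzMap.tsum_eq_tsum_fourier h 0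
  simp only [zero_add, hval] at hP
  rw [hP, ← tsum_mul_left]
  refine tsum_congr fun ℓ => ?_
  rw [QuotientAddGroup.mk_zero, fourier_eval_zero, mul_one, SchwartzMap.fourier_coe,
    Real.fourier_real_eq_integral_exp_smul, FT]
  have hsub := Measure.integral_comp_mul_right (fun y : ℝ =>
    (f y : ℂ) * Complex.exp (-(Complex.I * y * (2 * π * ℓ / N : ℝ)))) (N : ℝ)
  rw [abs_of_nonneg (by positivity)] at hsub
  have hNC : (N : ℂ) ≠ 0 := by exact_mod_cast hN.ne'
  have : (N : ℂ)⁻¹ = (((N : ℝ)⁻¹ : ℝ) : ℂ) := by push_cast; rfl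
  rw [this, ← Complex.real_smul, ← hsub]
  refine integral_congr_ae (Eventually.of_forall fun x => ?_)
  simp only [hval, smul_eq_mul]
  rw [mul_comm]
  congr 2
  push_cast
  field_simp

lemma tendsto_tsum_dilate (f : SchwartzMap ℝ ℝ) :
    Tendsto (fun N : ℕ => ∑' k : ℤ, (f (k * N) : ℂ)) atTop (𝓝 (f 0 : ℂ)) := by
  obtain ⟨C, hC, hdecay⟩ := f.decay 2 0
  have hsum : Summable fun k : ℤ => C * (1 / (k : ℝ) ^ 2) + if k = 0 then |f 0| else 0 :=
    ((Real.summable_one_div_int_pow.2 one_lt_two).mul_left C).add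
      (summable_of_ne_finset_zero (s := {0}) fun k hk => by simp_all)
  have hbound : ∀ x : ℝ, x ^ 2 * |f x| ≤ C := fun x => by
    simpa using hdecay x
  have hlim : ∀ k : ℤ, Tendsto (fun N : ℕ => (f (k * N) : ℂ)) atTop
      (𝓝 (if k = 0 then (f 0 : ℂ) else 0)) := by
    intro k
    split_ifs with hk
    · simp [hk]
    · have hinf : Tendsto (fun N : ℕ => (k : ℝ) * N) atTop (cocompact ℝ) := by
        rw [← Metric.cobounded_eq_cocompact, ← tendsto_norm_atTop_iff_cobounded]
        simp only [norm_mul, Real.norm_natCast]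
        exact tendsto_natCast_atTop_atTop.const_mul_atTop
          (norm_pos_iff.2 (Int.cast_ne_zero.2 hk))
      have := (Complex.continuous_ofReal.tendsto 0).comp ((zero_at_infty f).comp hinf)
      simpa [Function.comp_def] using this
  have := tendsto_tsum_of_dominated_convergence hsum hlim ?_
  · rwa [tsum_ite_eq] at this
  · filter_upwards [eventually_ge_atTop 1] with N hN k
    rw [Complex.norm_real, Real.norm_eq_abs]
    by_cases hk : k = 0
    · simp [hk]
    · have hk' : (0:ℝ) < (k : ℝ) ^ 2 := by positivity
      have hN' : (1:ℝ) ≤ N := by exact_mod_cast hN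
      have h1 := hbound (k * N)
      rw [if_neg hk, add_zero, mul_one_div, le_div_iff₀ hk', mul_comm]
      refine le_trans ?_ h1
      rw [mul_pow]
      exact mul_le_mul_of_nonneg_right (le_mul_of_one_le_right hk'.le (one_le_pow₀ hN'))
        (abs_nonneg _)

lemma exists_nat_FT_eq_zero {f : ℝ → ℝ} (hf : HasCompactSupport (FT f)) :
    ∃ R : ℕ, ∀ x : ℝ, R ≤ |x| → FT f x = 0 := by
  obtain ⟨r, hr⟩ := hf.isCompact.isBounded.subset_ball 0
  obtain ⟨R, hR⟩ := exists_nat_ge r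
  refine ⟨R, fun x hx => ?_⟩
  by_contra hne
  have := hr (subset_tsupport _ hne)
  rw [mem_ball_zero_iff, Real.norm_eq_abs] at this
  linarith

lemma norm_phaseSum_neg (φ : ℝ → ℝ) (t : ℝ) (N : ℕ) (ℓ : ℤ) (p : ℝ × ℝ) :
    ‖phaseSum φ t N (-ℓ) p‖ = ‖phaseSum φ t N ℓ p‖ := by
  rw [← Complex.norm_conj (phaseSum φ t N ℓ p), phaseSum, phaseSum, map_sum]
  congr 1
  refine Finset.sum_congr rfl fun j _ => ?_
  rw [← Complex.exp_conj, map_mul, Complex.conj_I, Complex.conj_ofReal]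
  congr 1
  push_cast
  ring

lemma phaseSum_zero (φ : ℝ → ℝ) (t : ℝ) (N : ℕ) (p : ℝ × ℝ) : phaseSum φ t N 0 p = N := by
  simp [phaseSum]

lemma tsum_int_eq_sum_Icc {F : ℤ → ℂ} {L : ℕ} (hF : ∀ ℓ : ℤ, (L : ℤ) < |ℓ| → F ℓ = 0) :
    ∑' ℓ : ℤ, F ℓ = F 0 + ∑ ℓ ∈ Finset.Icc 1 L, F ℓ + ∑ ℓ ∈ Finset.Icc 1 L, F (-ℓ) := by
  have hs : ∀ G : ℤ → ℂ, (∀ ℓ : ℤ, (L : ℤ) < |ℓ| → G ℓ = 0) →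
      HasSum (fun n : ℕ => G (n + 1)) (∑ ℓ ∈ Finset.Icc 1 L, G ℓ) := by
    intro G hG
    have : ∑ ℓ ∈ Finset.Icc 1 L, G ℓ = ∑ n ∈ Finset.range L, G ((n : ℤ) + 1) := by
      rw [Finset.range_eq_Ico, ← Finset.Ico_add_one_right_eq_Icc,
        ← Finset.sum_Ico_add' (fun n : ℕ => G n) 0 L 1]
      simp
    rw [this]
    refine hasSum_sum_of_ne_finset_zero fun n hn => hG _ ?_
    rw [Finset.mem_range] at hn
    rw [abs_of_nonneg (by positivity)]
    omega
  have h2 : HasSum (fun n : ℕ => F (-(n + 1))) (∑ ℓ ∈ Finset.Icc 1 L, F (-ℓ)) :=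
    hs (fun ℓ => F (-ℓ)) fun ℓ hℓ => hF _ (by rwa [abs_neg])
  rw [((hs F hF).of_add_one_of_neg_add_one h2).tsum_eq]
  ring

lemma pairCorrelation_eq (φ : ℝ → ℝ) (t : ℝ) {w : ℝ → ℂ} {R : ℕ}
    (hw : ∀ x : ℝ, R ≤ |x| → w x = 0) {N : ℕ} (hN : 0 < N) (p : ℝ × ℝ) :
    ((1 / (N : ℝ) ^ 2 : ℝ) : ℂ) * ∑' ℓ : ℤ, w (2 * π * ℓ / N) *
        ((‖phaseSum φ t N ℓ p‖ ^ 2 : ℝ) : ℂ) =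
      w 0 + offDiagSum φ t w N (R * N) p + offDiagSum φ t (fun x => w (-x)) N (R * N) p +
        ((N : ℂ)⁻¹ * ∑' ℓ : ℤ, w (2 * π * ℓ / N) - (N : ℂ)⁻¹ * w 0) := by
  have hN' : (0:ℝ) < N := by exact_mod_cast hN
  have hNC : (N : ℂ) ≠ 0 := by exact_mod_cast hN.ne'
  have hvan : ∀ ℓ : ℤ, ((R * N : ℕ) : ℤ) < |ℓ| → w (2 * π * ℓ / N) = 0 := by
    intro ℓ hℓ
    have hℓ' : (R : ℝ) * N < |(ℓ : ℝ)| := by exact_mod_cast hℓ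
    refine hw _ ?_
    rw [abs_div, abs_mul, abs_of_pos hN', abs_of_pos Real.two_pi_pos, le_div_iff₀ hN']
    nlinarith [Real.pi_gt_three, abs_nonneg (ℓ : ℝ)]
  rw [tsum_int_eq_sum_Icc hvan, tsum_int_eq_sum_Icc (L := R * N)
    (fun ℓ hℓ => by rw [hvan ℓ hℓ, zero_mul])]
  simp only [offDiagSum, norm_phaseSum_neg, phaseSum_zero, Complex.ofReal_sub, mul_sub,
    Finset.sum_sub_distrib, ← Finset.sum_mul, Int.cast_zero, mul_zero, zero_div, Int.cast_neg,
    Int.cast_natCast, mul_neg, neg_div, Complex.norm_natCast, mul_add]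
  push_cast
  field_simp
  ring

/-- Zelditch, Corollary 5.1.2: along the slightly sparse subsequence
`N_m = ⌊m (log m)⁵⌋`, the pair correlation functionals of the quantized maps
`exp(i t N (α φ(Î) + β Î))` converge to the Poisson limit `f(0) + f̂(0)` for
Lebesgue-almost every `(α,β) ∈ [−T,T]²` and every admissible test function `f`. -/
theorem pair_correlation_poisson_ae_along_subsequence
    (φ : ℝ → ℝ) (c C' : ℝ) (hc : 0 < c)
    (hφ : ContDiffOn ℝ 2 φ (Set.Icc 0 1))
    (hφ'' : ∀ x ∈ Set.Icc (0:ℝ) 1,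
      c ≤ |iteratedDerivWithin 2 φ (Set.Icc 0 1) x| ∧
      |iteratedDerivWithin 2 φ (Set.Icc 0 1) x| ≤ C')
    (t : ℝ) (ht : t ≠ 0) (T : ℝ) (hT : 0 < T) :
    ∀ᵐ p : ℝ × ℝ, p ∈ Set.Icc (-T) T ×ˢ Set.Icc (-T) T →
      ∀ f : SchwartzMap ℝ ℝ, HasCompactSupport (FT f) →
        Tendsto
          (fun m : ℕ =>
            let N : ℕ := Nat.floor ((m : ℝ) * Real.log m ^ 5)
            ((1 / (N : ℝ) ^ 2 : ℝ) : ℂ) * ∑' ℓ : ℤ, FT f (2 * π * ℓ / N) *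
              ((‖∑ j ∈ Finset.Icc 1 N, Complex.exp (Complex.I *
                  ((t * ℓ * N * (p.1 * φ ((j : ℝ) / N) + p.2 * ((j : ℝ) / N)) : ℝ)
                    : ℂ))‖ ^ 2 : ℝ) : ℂ))
          atTop (𝓝 ((f 0 : ℂ) + FT f 0)) := by
  filter_upwards [ae_forall_tendsto_offDiagSum hc ht hT hφ fun x hx => (hφ'' x hx).1]
    with p hp hpT f hf
  obtain ⟨R, hR⟩ := exists_nat_FT_eq_zero hf
  have hcont := continuous_FT f
  have hcast : Tendsto (fun m => ((sparseSeq m : ℕ) : ℂ)⁻¹) atTop (𝓝 0) :=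
    tendsto_inv₀_cobounded.comp
      (tendsto_natCast_atTop_cobounded.comp tendsto_sparseSeq)
  have hlim := ((tendsto_const_nhds (x := FT f 0)).add (hp hpT _ hcont R)).add
    (hp hpT _ (hcont.comp continuous_neg) R) |>.add
    (((tendsto_tsum_dilate f).comp tendsto_sparseSeq).sub (hcast.mul_const (FT f 0)))
  rw [zero_mul, sub_zero, add_zero, add_zero, add_comm] at hlim
  refine hlim.congr' ?_
  filter_upwards [tendsto_sparseSeq.eventually_ge_atTop 1] with m hm
  rw [Function.comp_apply, ← tsum_FT_div f hm]
  exact (pairCorrelation_eq φ t hR hm p).symm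
end

section
/- Fix T > 0 and a Schwartz function f whose Fourier transform f̂ is compactly supported. Then there is a constant C such that for all integers N ≥ 2, | (1/N²) Σ_{ℓ∈ℤ, ℓ≠0} f̂(ℓ/N) · (1/(2T)) ∫_{−T}^{T} Σ_{1≤j,k≤N, j≠k} exp( i ℓ t (j² − k²)/N ) dt | ≤ C (log N)² / N. -/
open MeasureTheory Filter Topology Real

/-- Abel summation bound: if the partial sums of `a` are at most `A`, then a sum weighted by `c` is
controlled by the last weight and the variation of the weights. -/
theorem norm_sum_range_mul_le_of_partial_sums (c a : ℕ → ℂ) (A : ℝ)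
    (hA : ∀ n, ‖∑ i ∈ Finset.range n, a i‖ ≤ A) (n : ℕ) :
    ‖∑ i ∈ Finset.range n, c i * a i‖ ≤
      A * (‖c n‖ + ∑ i ∈ Finset.range n, ‖c (i + 1) - c i‖) := by
  have parts : ∑ i ∈ Finset.range n, c i * a i = c n * ∑ i ∈ Finset.range n, a i -
      ∑ i ∈ Finset.range n, (c (i + 1) - c i) * ∑ k ∈ Finset.range (i + 1), a k := by
    induction n with
    | zero => simp
    | succ n ih =>
      rw [Finset.sum_range_succ, ih, Finset.sum_range_succ (fun i => (c (i + 1) - c i) * _),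
        Finset.sum_range_succ a n]
      ring
  rw [parts, mul_add, Finset.mul_sum _ _ A]
  refine (norm_sub_le _ _).trans (add_le_add ?_ ?_)
  · rw [norm_mul, mul_comm]
    exact mul_le_mul_of_nonneg_right (hA n) (norm_nonneg _)
  · refine (norm_sum_le _ _).trans (Finset.sum_le_sum fun i _ => ?_)
    rw [norm_mul, mul_comm]
    exact mul_le_mul_of_nonneg_right (hA _) (norm_nonneg _)

theorem two_mul_sin_half_mul_sum_sin (θ a : ℝ) (n : ℕ) :
    2 * sin (θ / 2) * ∑ i ∈ Finset.range n, sin ((i + a) * θ) =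
      cos ((a - 1 / 2) * θ) - cos ((n + a - 1 / 2) * θ) := by
  induction n with
  | zero => simp
  | succ n ih =>
    rw [Finset.sum_range_succ, mul_add, ih]
    have h₁ : ((n : ℝ) + a - 1 / 2) * θ = (n + a) * θ - θ / 2 := by ring
    have h₂ : (((n + 1 : ℕ) : ℝ) + a - 1 / 2) * θ = (n + a) * θ + θ / 2 := by
      push_cast; ring
    rw [h₁, h₂, cos_sub, cos_add]
    ring

theorem abs_sum_sin_le (θ a : ℝ) (h : sin (θ / 2) ≠ 0) (n : ℕ) :
    |∑ i ∈ Finset.range n, sin ((i + a) * θ)| ≤ 1 / |sin (θ / 2)| := by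
  have hpos : 0 < |sin (θ / 2)| := abs_pos.mpr h
  rw [le_div_iff₀ hpos]
  have key := congrArg abs (two_mul_sin_half_mul_sum_sin θ a n)
  rw [abs_mul, abs_mul, abs_two] at key
  have h₁ := abs_cos_le_one ((a - 1 / 2) * θ)
  have h₂ := abs_cos_le_one ((n + a - 1 / 2) * θ)
  have h₃ := abs_sub (cos ((a - 1 / 2) * θ)) (cos ((n + a - 1 / 2) * θ))
  nlinarith

theorem abs_sin_nat_mul_le (n : ℕ) (θ : ℝ) : |sin (n * θ)| ≤ n * |sin θ| := by
  induction n with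
  | zero => simp
  | succ n ih =>
    have h : ((n + 1 : ℕ) : ℝ) * θ = n * θ + θ := by push_cast; ring
    rw [h, sin_add]
    refine (abs_add_le _ _).trans ?_
    rw [abs_mul, abs_mul]
    have h₁ := abs_cos_le_one θ
    have h₂ := abs_cos_le_one (n * θ)
    push_cast
    nlinarith [abs_nonneg (sin θ), abs_nonneg (sin (n * θ))]

theorem abs_sin_le_two_mul_abs_sin_half (θ : ℝ) : |sin θ| ≤ 2 * |sin (θ / 2)| := by
  have h : sin θ = 2 * sin (θ / 2) * cos (θ / 2) := by
    rw [← sin_two_mul]; congr 1; ring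
  rw [h, abs_mul, abs_mul, abs_two]
  exact mul_le_of_le_one_right (by positivity) (abs_cos_le_one _)

/-- The partial sums of `∑ sin (ℓ θ) / ℓ` are bounded uniformly in `θ`. -/
theorem norm_sum_sin_div_le (θ : ℝ) (n : ℕ) :
    ‖∑ i ∈ Finset.range n, ((sin (((i : ℝ) + 1) * θ) / ((i : ℝ) + 1) : ℝ) : ℂ)‖ ≤ 3 := by
  set δ := |sin (θ / 2)| with hδ
  have term : ∀ i : ℕ,
      ‖((sin (((i : ℝ) + 1) * θ) / ((i : ℝ) + 1) : ℝ) : ℂ)‖ ≤ 2 * δ := by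
    intro i
    rw [Complex.norm_real, Real.norm_eq_abs, abs_div, abs_of_pos (by positivity : (0:ℝ) < i + 1),
      div_le_iff₀ (by positivity)]
    have h₁ := abs_sin_nat_mul_le (i + 1) θ
    have h₂ := abs_sin_le_two_mul_abs_sin_half θ
    push_cast at h₁
    have h₃ : (0 : ℝ) ≤ (i : ℝ) + 1 := by positivity
    nlinarith
  have head : ∀ m : ℕ, ‖∑ i ∈ Finset.range m,
      ((sin (((i : ℝ) + 1) * θ) / ((i : ℝ) + 1) : ℝ) : ℂ)‖ ≤ m * (2 * δ) := by
    intro m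
    refine (norm_sum_le_of_le _ fun i _ => term i).trans ?_
    simp
  by_cases h0 : sin (θ / 2) = 0
  · have := head n
    rw [hδ, h0] at this
    simp only [abs_zero, mul_zero] at this
    linarith
  have hpos : 0 < δ := abs_pos.mpr h0
  set M := ⌊1 / δ⌋₊ with hM
  have hMle : (M : ℝ) * δ ≤ 1 := by
    have := Nat.floor_le (by positivity : 0 ≤ 1 / δ)
    rwa [le_div_iff₀ hpos] at this
  have hMlt : 1 < ((M : ℝ) + 1) * δ := by
    have := Nat.lt_floor_add_one (1 / δ)
    rwa [div_lt_iff₀ hpos] at this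
  rcases le_total n M with h | h
  · have h₁ := head n
    have h₂ : (n : ℝ) ≤ M := by exact_mod_cast h
    nlinarith
  obtain ⟨r, rfl⟩ := Nat.exists_eq_add_of_le h
  rw [Finset.sum_range_add]
  have htail := norm_sum_range_mul_le_of_partial_sums
    (fun i => ((1 / ((i : ℝ) + (M + 1)) : ℝ) : ℂ))
    (fun i => ((sin (((i : ℝ) + (M + 1)) * θ) : ℝ) : ℂ)) (1 / δ)
    (fun m => by
      rw [← Complex.ofReal_sum, Complex.norm_real]
      exact abs_sum_sin_le θ _ h0 m) r
  have hvar : ‖((1 / ((r : ℝ) + (M + 1)) : ℝ) : ℂ)‖ + ∑ i ∈ Finset.range r,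
      ‖((1 / (((i + 1 : ℕ) : ℝ) + (M + 1)) : ℝ) : ℂ) - ((1 / ((i : ℝ) + (M + 1)) : ℝ) : ℂ)‖ =
      1 / ((M : ℝ) + 1) := by
    have h₁ : ∀ i : ℕ,
        ‖((1 / (((i + 1 : ℕ) : ℝ) + (M + 1)) : ℝ) : ℂ) - ((1 / ((i : ℝ) + (M + 1)) : ℝ) : ℂ)‖ =
        1 / ((i : ℝ) + (M + 1)) - 1 / (((i + 1 : ℕ) : ℝ) + (M + 1)) := by
      intro i
      rw [← Complex.ofReal_sub, Complex.norm_real, Real.norm_eq_abs, abs_sub_comm, abs_of_nonneg]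
      rw [sub_nonneg]
      apply one_div_le_one_div_of_le (by positivity)
      push_cast; linarith
    rw [Finset.sum_congr rfl fun i _ => h₁ i,
      Finset.sum_range_sub' (fun i : ℕ => 1 / ((i : ℝ) + (M + 1))), Complex.norm_real,
      Real.norm_eq_abs, abs_of_pos (by positivity)]
    simp
  rw [hvar] at htail
  have hone : 1 / δ * (1 / ((M : ℝ) + 1)) ≤ 1 := by
    rw [div_mul_div_comm, one_mul, div_le_one (by positivity)]
    nlinarith
  have heq : ∑ i ∈ Finset.range r, ((sin ((((M + i : ℕ) : ℝ) + 1) * θ) /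
      (((M + i : ℕ) : ℝ) + 1) : ℝ) : ℂ) = ∑ i ∈ Finset.range r,
      ((1 / ((i : ℝ) + (M + 1)) : ℝ) : ℂ) * ((sin (((i : ℝ) + (M + 1)) * θ) : ℝ) : ℂ) := by
    refine Finset.sum_congr rfl fun i _ => ?_
    have h₁ : ((M + i : ℕ) : ℝ) + 1 = (i : ℝ) + (M + 1) := by push_cast; ring
    rw [h₁, ← Complex.ofReal_mul]
    congr 1
    ring
  rw [heq]
  have := norm_add_le (∑ i ∈ Finset.range M,
      ((sin (((i : ℝ) + 1) * θ) / ((i : ℝ) + 1) : ℝ) : ℂ)) (∑ i ∈ Finset.range r,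
      ((1 / ((i : ℝ) + (M + 1)) : ℝ) : ℂ) * ((sin (((i : ℝ) + (M + 1)) * θ) : ℝ) : ℂ))
  have h₁ := head M
  linarith

theorem sum_Icc_one_div_le_one_add_log (N : ℕ) :
    ∑ i ∈ Finset.Icc 1 N, 1 / (i : ℝ) ≤ 1 + log N := by
  have h := harmonic_le_one_add_log N
  rw [harmonic_eq_sum_Icc] at h
  push_cast at h
  simpa [one_div] using h

theorem sum_one_div_abs_sub_le (N j : ℕ) (hj : j ≤ N) :
    ∑ k ∈ Finset.Icc 1 N, (if j ≠ k then 1 / |(j : ℝ) - k| else 0) ≤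
      2 * ∑ i ∈ Finset.Icc 1 N, 1 / (i : ℝ) := by
  have split : ∀ k : ℕ, (if j ≠ k then 1 / |(j : ℝ) - k| else 0) =
      (if k < j then 1 / ((j - k : ℕ) : ℝ) else 0) +
        (if j < k then 1 / ((k - j : ℕ) : ℝ) else 0) := by
    intro k
    rcases lt_trichotomy k j with h | h | h
    · have hk : (k : ℝ) < j := by exact_mod_cast h
      rw [if_pos h.ne', if_pos h, if_neg h.not_gt, add_zero, abs_of_pos (sub_pos.mpr hk),
        Nat.cast_sub h.le]
    · simp [h]
    · have hk : (j : ℝ) < k := by exact_mod_cast h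
      rw [if_pos h.ne, if_neg h.not_gt, if_pos h, zero_add, abs_sub_comm,
        abs_of_pos (sub_pos.mpr hk), Nat.cast_sub h.le]
  have reindex : ∀ (s : Finset ℕ) (φ : ℕ → ℕ), Set.InjOn φ s →
      (∀ k ∈ s, φ k ∈ Finset.Icc 1 N) →
      ∑ k ∈ s, 1 / (φ k : ℝ) ≤ ∑ i ∈ Finset.Icc 1 N, 1 / (i : ℝ) := by
    intro s φ hφ hs
    rw [← Finset.sum_image (f := fun i : ℕ => 1 / (i : ℝ)) hφ]
    refine Finset.sum_le_sum_of_subset_of_nonneg ?_ fun i _ _ => by positivity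
    intro i hi
    obtain ⟨k, hk, rfl⟩ := Finset.mem_image.mp hi
    exact hs k hk
  rw [Finset.sum_congr rfl fun k _ => split k, Finset.sum_add_distrib, ← Finset.sum_filter,
    ← Finset.sum_filter, two_mul]
  refine add_le_add (reindex _ (fun k => j - k) ?_ ?_) (reindex _ (fun k => k - j) ?_ ?_)
  · intro x hx y hy hxy
    simp only [Finset.coe_filter, Set.mem_ofPred_eq] at hx hy hxy
    omega
  · intro k hk
    simp only [Finset.mem_filter, Finset.mem_Icc] at hk ⊢
    omega
  · intro x hx y hy hxy
    simp only [Finset.coe_filter, Set.mem_ofPred_eq] at hx hy hxy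
    omega
  · intro k hk
    simp only [Finset.mem_filter, Finset.mem_Icc] at hk ⊢
    omega

theorem sum_one_div_abs_sq_sub_sq_le (N : ℕ) (hN : 2 ≤ N) :
    ∑ j ∈ Finset.Icc 1 N, ∑ k ∈ Finset.Icc 1 N,
      (if j ≠ k then 1 / |(j : ℝ) ^ 2 - (k : ℝ) ^ 2| else 0) ≤ 18 * log N ^ 2 := by
  set H := ∑ i ∈ Finset.Icc 1 N, 1 / (i : ℝ) with hH
  have hH0 : 0 ≤ H := Finset.sum_nonneg fun i _ => by positivity
  have hlog : H ≤ 3 * log N := by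
    have h₁ := sum_Icc_one_div_le_one_add_log N
    have h₂ : log 2 ≤ log N := log_le_log (by norm_num) (by exact_mod_cast hN)
    have h₃ := log_two_gt_d9
    linarith
  have hrow : ∀ j ∈ Finset.Icc 1 N, ∑ k ∈ Finset.Icc 1 N,
      (if j ≠ k then 1 / |(j : ℝ) ^ 2 - (k : ℝ) ^ 2| else 0) ≤ 1 / (j : ℝ) * (2 * H) := by
    intro j hj
    rw [Finset.mem_Icc] at hj
    have hj1 : (1 : ℝ) ≤ j := by exact_mod_cast hj.1
    refine le_trans ?_ (mul_le_mul_of_nonneg_left (sum_one_div_abs_sub_le N j hj.2)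
      (by positivity : 0 ≤ 1 / (j : ℝ)))
    rw [Finset.mul_sum]
    refine Finset.sum_le_sum fun k _ => ?_
    by_cases hjk : j = k
    · simp [hjk]
    rw [if_pos hjk, if_pos hjk, div_mul_div_comm, one_mul]
    have hne : (j : ℝ) - k ≠ 0 := sub_ne_zero.mpr (by exact_mod_cast hjk)
    have hk0 : (0 : ℝ) ≤ k := k.cast_nonneg
    apply one_div_le_one_div_of_le (mul_pos (by linarith) (abs_pos.mpr hne))
    rw [sq_sub_sq, abs_mul, abs_of_pos (by linarith : (0 : ℝ) < j + k)]
    exact mul_le_mul_of_nonneg_right (by linarith) (abs_nonneg _)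
  refine (Finset.sum_le_sum hrow).trans ?_
  rw [← Finset.sum_mul, ← hH]
  nlinarith

theorem norm_FT_le (f : SchwartzMap ℝ ℝ) (ξ : ℝ) : ‖FT f ξ‖ ≤ ∫ x, ‖f x‖ := by
  refine (norm_integral_le_integral_norm _).trans (le_of_eq ?_)
  congr 1
  ext x
  have h : -(Complex.I * x * ξ) = ((-(x * ξ) : ℝ) : ℂ) * Complex.I := by push_cast; ring
  rw [norm_mul, h, Complex.norm_exp_ofReal_mul_I, mul_one, Complex.norm_real]

theorem norm_FT_sub_le (f : SchwartzMap ℝ ℝ) (ξ η : ℝ) :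
    ‖FT f ξ - FT f η‖ ≤ (∫ x, ‖x‖ * ‖f x‖) * |ξ - η| := by
  have hphase : ∀ x ζ : ℝ, Complex.exp (-(Complex.I * x * ζ)) =
      Complex.exp (Complex.I * ((-(x * ζ) : ℝ) : ℂ)) := by
    intro x ζ; congr 1; push_cast; ring
  have hint : ∀ ζ : ℝ, Integrable fun x : ℝ =>
      (f x : ℂ) * Complex.exp (-(Complex.I * x * ζ)) := by
    intro ζ
    have hf : Integrable fun x => ‖f x‖ := f.integrable.norm
    refine hf.mono' ?_ (Eventually.of_forall fun x => ?_)
    · have := f.continuous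
      exact (by fun_prop : Continuous fun x : ℝ =>
        (f x : ℂ) * Complex.exp (-(Complex.I * x * ζ))).aestronglyMeasurable
    · rw [norm_mul, hphase, Complex.norm_exp_I_mul_ofReal, mul_one, Complex.norm_real]
  have hint₁ : Integrable fun x : ℝ => ‖x‖ * ‖f x‖ := by
    simpa using f.integrable_pow_mul volume 1
  rw [FT, FT, ← integral_sub (hint ξ) (hint η), ← integral_mul_const]
  refine norm_integral_le_of_norm_le (hint₁.mul_const _) (Eventually.of_forall fun x => ?_)
  rw [← mul_sub, norm_mul, Complex.norm_real, mul_comm ‖x‖, mul_assoc ‖f x‖]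
  refine mul_le_mul_of_nonneg_left ?_ (norm_nonneg _)
  rw [hphase, hphase]
  have hfac : Complex.exp (Complex.I * ((-(x * ξ) : ℝ) : ℂ)) -
      Complex.exp (Complex.I * ((-(x * η) : ℝ) : ℂ)) =
      Complex.exp (Complex.I * ((-(x * η) : ℝ) : ℂ)) *
        (Complex.exp (Complex.I * ((x * (η - ξ) : ℝ) : ℂ)) - 1) := by
    rw [mul_sub, ← Complex.exp_add, mul_one]
    congr 2
    push_cast; ring
  rw [hfac, norm_mul, Complex.norm_exp_I_mul_ofReal, one_mul]
  refine Real.norm_exp_I_mul_ofReal_sub_one_le.trans (le_of_eq ?_)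
  rw [norm_mul, Real.norm_eq_abs (η - ξ), abs_sub_comm]

/-- Time average of a nontrivial character. -/
theorem time_average_exp (T a : ℝ) (ha : a ≠ 0) :
    ((1 / (2 * T) : ℝ) : ℂ) * ∫ t in (-T)..T, Complex.exp (Complex.I * ((t * a : ℝ) : ℂ)) =
      ((sin (T * a) / (T * a) : ℝ) : ℂ) := by
  have hc : Complex.I * (a : ℂ) ≠ 0 :=
    mul_ne_zero Complex.I_ne_zero (Complex.ofReal_ne_zero.mpr ha)
  have hfun : (fun t : ℝ => Complex.exp (Complex.I * ((t * a : ℝ) : ℂ))) =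
      fun t : ℝ => Complex.exp (Complex.I * a * t) := by
    ext t; congr 1; push_cast; ring
  rw [hfun, integral_exp_mul_complex hc]
  have hsin : Complex.exp (Complex.I * a * T) - Complex.exp (Complex.I * a * (-T : ℝ)) =
      2 * Complex.I * Complex.sin (T * a) := by
    rw [Complex.sin]
    have h₁ : Complex.I * a * ((-T : ℝ) : ℂ) = -(T * a) * Complex.I := by push_cast; ring
    have h₂ : Complex.I * a * (T : ℂ) = (T * a) * Complex.I := by ring
    rw [h₁, h₂]
    linear_combination (Complex.exp (T * a * Complex.I) - Complex.exp (-(T * a) * Complex.I)) *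
      Complex.I_sq
  rw [hsin]
  push_cast
  have ha' : (a : ℂ) ≠ 0 := Complex.ofReal_ne_zero.mpr ha
  by_cases hT : (T : ℂ) = 0
  · simp [hT]
  field_simp [Complex.I_ne_zero]

/-- The sum over one ray of frequencies, with weights of bounded variation, is uniformly bounded. -/
theorem norm_sum_FT_mul_sin_div_le (f : SchwartzMap ℝ ℝ) (ε : ℝ) (hε : |ε| = 1) (N R : ℕ)
    (hN : 0 < N) (θ : ℝ) :
    ‖∑ n ∈ Finset.range (R * N), FT f (ε * ((n : ℝ) + 1) / N) *
      ((sin (((n : ℝ) + 1) * θ) / ((n : ℝ) + 1) : ℝ) : ℂ)‖ ≤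
      3 * ((∫ x, ‖f x‖) + R * ∫ x, ‖x‖ * ‖f x‖) := by
  have hN' : (0 : ℝ) < N := by exact_mod_cast hN
  refine (norm_sum_range_mul_le_of_partial_sums (fun n : ℕ => FT f (ε * ((n : ℝ) + 1) / N)) _ 3
    (norm_sum_sin_div_le θ) (R * N)).trans ?_
  refine mul_le_mul_of_nonneg_left (add_le_add (norm_FT_le f _) ?_) (by norm_num)
  refine (Finset.sum_le_sum (g := fun _ => (∫ x, ‖x‖ * ‖f x‖) * (1 / N))
    fun n _ => ?_).trans (le_of_eq ?_)
  · refine (norm_FT_sub_le f _ _).trans (le_of_eq ?_)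
    have h : ε * (((n + 1 : ℕ) : ℝ) + 1) / N - ε * ((n : ℝ) + 1) / N = ε * (1 / N) := by
      push_cast; ring
    rw [h, abs_mul, hε, one_mul, abs_of_pos (by positivity)]
  · rw [Finset.sum_const, Finset.card_range, nsmul_eq_mul]
    push_cast
    field_simp

/-- The off-diagonal time average at frequency `ℓ`. -/
theorem time_average_off_diagonal (T : ℝ) (N : ℕ) (hN : 0 < N) (l : ℝ) (hl : l ≠ 0) :
    ((1 / (2 * T) : ℝ) : ℂ) * ∫ t in (-T)..T,
      ∑ j ∈ Finset.Icc 1 N, ∑ k ∈ Finset.Icc 1 N,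
        (if j ≠ k then
          Complex.exp (Complex.I * ((l * t * ((j : ℝ) ^ 2 - (k : ℝ) ^ 2) / N : ℝ) : ℂ))
        else 0) =
      ∑ j ∈ Finset.Icc 1 N, ∑ k ∈ Finset.Icc 1 N, (if j ≠ k then
        ((N / (T * ((j : ℝ) ^ 2 - (k : ℝ) ^ 2)) : ℝ) : ℂ) *
          ((sin (l * (T * ((j : ℝ) ^ 2 - (k : ℝ) ^ 2) / N)) / l : ℝ) : ℂ) else 0) := by
  have hN' : (N : ℝ) ≠ 0 := by positivity
  have hcont : ∀ j k : ℕ, Continuous fun t : ℝ => (if j ≠ k then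
      Complex.exp (Complex.I * ((l * t * ((j : ℝ) ^ 2 - (k : ℝ) ^ 2) / N : ℝ) : ℂ)) else 0) := by
    intro j k
    by_cases h : j = k
    · simp only [h, ne_eq, not_true_eq_false, if_false]
      exact continuous_const
    · simp only [ne_eq, h, not_false_eq_true, if_true]
      fun_prop
  rw [intervalIntegral.integral_finsetSum fun j _ =>
    (continuous_finsetSum _ fun k _ => hcont j k).intervalIntegrable _ _, Finset.mul_sum]
  refine Finset.sum_congr rfl fun j hj => ?_
  rw [intervalIntegral.integral_finsetSum fun k _ => (hcont j k).intervalIntegrable _ _,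
    Finset.mul_sum]
  refine Finset.sum_congr rfl fun k hk => ?_
  by_cases h : j = k
  · simp [h]
  have hm : (j : ℝ) ^ 2 - (k : ℝ) ^ 2 ≠ 0 := by
    rw [sub_ne_zero, ne_eq, sq_eq_sq₀ j.cast_nonneg k.cast_nonneg]
    exact_mod_cast h
  simp only [ne_eq, h, not_false_eq_true, if_true]
  have hav := time_average_exp T (l * ((j : ℝ) ^ 2 - (k : ℝ) ^ 2) / N)
    (div_ne_zero (mul_ne_zero hl hm) hN')
  have hfun : ∀ t : ℝ, t * (l * ((j : ℝ) ^ 2 - (k : ℝ) ^ 2) / N) =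
      l * t * ((j : ℝ) ^ 2 - (k : ℝ) ^ 2) / N := fun t => by ring
  simp only [hfun] at hav
  rw [hav, ← Complex.ofReal_mul]
  congr 1
  have harg : l * T * ((j : ℝ) ^ 2 - (k : ℝ) ^ 2) / N =
      l * (T * ((j : ℝ) ^ 2 - (k : ℝ) ^ 2) / N) := by ring
  rw [harg]
  by_cases hT : T = 0
  · simp [hT]
  field_simp

/-- One ray of frequencies contributes `O (N (log N)²)`. -/
theorem norm_sum_FT_mul_off_diagonal_le (T : ℝ) (hT : 0 < T) (f : SchwartzMap ℝ ℝ) (ε : ℝ)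
    (hε : ε = 1 ∨ ε = -1) (N R : ℕ) (hN : 2 ≤ N) :
    ‖∑ n ∈ Finset.range (R * N), FT f (ε * ((n : ℝ) + 1) / N) *
      ∑ j ∈ Finset.Icc 1 N, ∑ k ∈ Finset.Icc 1 N, (if j ≠ k then
        ((N / (T * ((j : ℝ) ^ 2 - (k : ℝ) ^ 2)) : ℝ) : ℂ) *
          ((sin (ε * ((n : ℝ) + 1) * (T * ((j : ℝ) ^ 2 - (k : ℝ) ^ 2) / N)) /
            (ε * ((n : ℝ) + 1)) : ℝ) : ℂ) else 0)‖ ≤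
      N / T * (3 * ((∫ x, ‖f x‖) + R * ∫ x, ‖x‖ * ‖f x‖)) * (18 * log N ^ 2) := by
  set D := 3 * ((∫ x, ‖f x‖) + R * ∫ x, ‖x‖ * ‖f x‖) with hD
  have hD0 : 0 ≤ D := by positivity
  have hodd : ∀ y θ : ℝ, sin (ε * y * θ) / (ε * y) = sin (y * θ) / y := by
    intro y θ
    rcases hε with rfl | rfl
    · simp
    · rw [neg_one_mul, neg_mul, sin_neg, neg_div_neg_eq]
  simp only [hodd, Finset.mul_sum]
  rw [Finset.sum_comm]
  have hbound := mul_le_mul_of_nonneg_left (sum_one_div_abs_sq_sub_sq_le N hN)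
    (by positivity : 0 ≤ N / T * D)
  refine le_trans ?_ hbound
  rw [Finset.mul_sum]
  refine norm_sum_le_of_le _ fun j _ => ?_
  rw [Finset.sum_comm, Finset.mul_sum]
  refine norm_sum_le_of_le _ fun k _ => ?_
  by_cases h : j = k
  · simp [h]
  simp only [ne_eq, h, not_false_eq_true, if_true, mul_left_comm (FT f _)]
  rw [← Finset.mul_sum, norm_mul]
  have hsum := norm_sum_FT_mul_sin_div_le f ε (by rcases hε with rfl | rfl <;> simp) N R
    (by omega) (T * ((j : ℝ) ^ 2 - (k : ℝ) ^ 2) / N)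
  refine (mul_le_mul_of_nonneg_left hsum (norm_nonneg _)).trans (le_of_eq ?_)
  rw [← hD, Complex.norm_real, Real.norm_eq_abs, abs_div, abs_mul, abs_of_pos hT, Nat.abs_cast,
    div_mul_eq_div_mul_one_div]
  ring

/-- Zelditch, Proposition 6.1.1: for the pure quadratic Hamiltonian `Î²` on CP¹, the
off-diagonal part of the level-`N` pair correlation functional, averaged over
`t ∈ [−T,T]`, is `O((log N)²/N)`. -/
theorem quadratic_time_average_off_diagonal_bound
    (T : ℝ) (hT : 0 < T) (f : SchwartzMap ℝ ℝ) (hf : HasCompactSupport (FT f)) :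
    ∃ C : ℝ, ∀ N : ℕ, 2 ≤ N →
      ‖((1 / (N : ℝ) ^ 2 : ℝ) : ℂ) * ∑' ℓ : ℤ, (if ℓ = 0 then 0 else
          FT f ((ℓ : ℝ) / N) * (((1 / (2 * T) : ℝ) : ℂ) * ∫ t in (-T)..T,
            ∑ j ∈ Finset.Icc 1 N, ∑ k ∈ Finset.Icc 1 N,
              if j ≠ k then
                Complex.exp (Complex.I *
                  (((ℓ : ℝ) * t * ((j : ℝ) ^ 2 - (k : ℝ) ^ 2) / N : ℝ) : ℂ))
              else 0))‖
        ≤ C * (Real.log N) ^ 2 / N := by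
  obtain ⟨R, hR⟩ : ∃ R : ℕ, ∀ ξ : ℝ, (R : ℝ) < |ξ| → FT f ξ = 0 := by
    obtain ⟨r, hr⟩ := hf.isBounded.subset_closedBall (0 : ℝ)
    obtain ⟨R, hrR⟩ := exists_nat_ge r
    refine ⟨R, fun ξ hξ => image_eq_zero_of_notMem_tsupport fun hmem => ?_⟩
    have := hr hmem
    rw [Metric.mem_closedBall, dist_zero_right, Real.norm_eq_abs] at this
    linarith
  set D := 3 * ((∫ x, ‖f x‖) + R * ∫ x, ‖x‖ * ‖f x‖) with hD
  refine ⟨36 * D / T, fun N hN => ?_⟩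
  have hN0 : 0 < N := by omega
  have hN' : (0 : ℝ) < N := by exact_mod_cast hN0
  set h : ℤ → ℂ := fun ℓ => if ℓ = 0 then 0 else FT f ((ℓ : ℝ) / N) *
      ∑ j ∈ Finset.Icc 1 N, ∑ k ∈ Finset.Icc 1 N, (if j ≠ k then
        ((N / (T * ((j : ℝ) ^ 2 - (k : ℝ) ^ 2)) : ℝ) : ℂ) *
          ((sin ((ℓ : ℝ) * (T * ((j : ℝ) ^ 2 - (k : ℝ) ^ 2) / N)) / (ℓ : ℝ) : ℝ) : ℂ) else 0)
    with hh
  have hterm : ∀ ℓ : ℤ, (if ℓ = 0 then (0 : ℂ) else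
      FT f ((ℓ : ℝ) / N) * (((1 / (2 * T) : ℝ) : ℂ) * ∫ t in (-T)..T,
        ∑ j ∈ Finset.Icc 1 N, ∑ k ∈ Finset.Icc 1 N,
          if j ≠ k then
            Complex.exp (Complex.I *
              (((ℓ : ℝ) * t * ((j : ℝ) ^ 2 - (k : ℝ) ^ 2) / N : ℝ) : ℂ))
          else 0)) = h ℓ := by
    intro ℓ
    by_cases h0 : ℓ = 0
    · simp [hh, h0]
    · rw [hh, if_neg h0, time_average_off_diagonal T N hN0 ℓ (by exact_mod_cast h0)]
      simp only [if_neg h0]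
  rw [tsum_congr hterm]
  have hray : ∀ ε : ℤ, ε = 1 ∨ ε = -1 →
      (∀ n ∉ Finset.range (R * N), h (ε * ((n : ℤ) + 1)) = 0) ∧
      ‖∑ n ∈ Finset.range (R * N), h (ε * ((n : ℤ) + 1))‖ ≤ N / T * D * (18 * log N ^ 2) := by
    intro ε hε
    have hne : ∀ n : ℕ, ε * ((n : ℤ) + 1) ≠ 0 := by
      intro n; rcases hε with rfl | rfl <;> omega
    constructor
    · intro n hn
      have hn' : ((R * N : ℕ) : ℝ) ≤ n := by
        exact_mod_cast not_lt.mp (Finset.mem_range.not.mp hn)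
      have habs : |(ε : ℝ)| = 1 := by rcases hε with rfl | rfl <;> simp
      simp only [hh, if_neg (hne n)]
      rw [hR, zero_mul]
      push_cast at hn' ⊢
      rw [abs_div, abs_mul, habs, one_mul, Nat.abs_cast, lt_div_iff₀ hN',
        abs_of_pos (by positivity)]
      linarith
    · have := norm_sum_FT_mul_off_diagonal_le T hT f ε
        (by rcases hε with rfl | rfl <;> simp) N R hN
      simp only [hh, if_neg (hne _)]
      push_cast at this ⊢
      exact this
  obtain ⟨hz₁, hb₁⟩ := hray 1 (Or.inl rfl)
  obtain ⟨hz₂, hb₂⟩ := hray (-1) (Or.inr rfl)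
  simp only [one_mul, neg_one_mul] at hz₁ hb₁ hz₂ hb₂
  rw [tsum_of_add_one_of_neg_add_one (summable_of_ne_finset_zero hz₁)
    (summable_of_ne_finset_zero hz₂), tsum_eq_sum hz₁, tsum_eq_sum hz₂]
  have h0 : h 0 = 0 := by simp [hh]
  rw [h0, add_zero, norm_mul, Complex.norm_real, Real.norm_eq_abs, abs_of_pos (by positivity)]
  refine (mul_le_mul_of_nonneg_left ((norm_add_le _ _).trans (add_le_add hb₁ hb₂))
    (by positivity)).trans (le_of_eq ?_)
  field_simp
  ring
end

section
/- Let f be a Schwartz function whose Fourier transform f̂ is supported in (−2π, 2π). Then, as p → ∞ through prime numbers, (1/p²) Σ_{ℓ∈ℤ, ℓ≠0} f̂(2πℓ/p) |Σ_{j=1}^{p} exp(2πi ℓ j²/p)|² → f(0). -/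
open MeasureTheory Filter Topology Real

/-- The complete quadratic Gauss sum over `ZMod p` has square modulus `p`. -/
theorem norm_sq_sum_addChar_mul_sq {p : ℕ} [Fact p.Prime] (hp : p ≠ 2)
    {ψ : AddChar (ZMod p) ℂ} (hψ : ψ.IsPrimitive) {a : ZMod p} (ha : a ≠ 0) :
    ‖∑ x : ZMod p, ψ (a * x ^ 2)‖ ^ 2 = (p : ℝ) := by
  have h2 : (2 : ZMod p) ≠ 0 := Ring.two_ne_zero (by rwa [ZMod.ringChar_zmod_n])
  have key : (∑ x : ZMod p, ψ (a * x ^ 2)) * (starRingEnd ℂ) (∑ y : ZMod p, ψ (a * y ^ 2))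
      = p := by
    rw [map_sum, Finset.sum_mul_sum, Finset.sum_comm]
    calc ∑ y : ZMod p, ∑ x : ZMod p, ψ (a * x ^ 2) * (starRingEnd ℂ) (ψ (a * y ^ 2))
        = ∑ y : ZMod p, ∑ h : ZMod p, ψ (a * h ^ 2) * ψ (y * (2 * a * h)) := by
          refine Finset.sum_congr rfl fun y _ => ?_
          rw [← Equiv.sum_comp (Equiv.addRight y)]
          refine Finset.sum_congr rfl fun h _ => ?_
          rw [← AddChar.map_neg_eq_conj, ← AddChar.map_add_eq_mul, ← AddChar.map_add_eq_mul]
          congr 1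
          simp only [Equiv.coe_addRight]
          ring
      _ = ∑ h : ZMod p, ψ (a * h ^ 2) * ∑ y : ZMod p, ψ (y * (2 * a * h)) := by
          rw [Finset.sum_comm]
          simp_rw [Finset.mul_sum]
      _ = p := by
          simp_rw [AddChar.sum_mulShift _ hψ]
          simp [h2, ha, ZMod.card]
  rw [Complex.mul_conj, Complex.normSq_eq_norm_sq] at key
  exact_mod_cast key

/-- Summing over `1, …, p` is the same as summing over the residue classes modulo `p`. -/
theorem sum_Icc_natCast_zmod {M : Type*} [AddCommMonoid M] (p : ℕ) [NeZero p] (F : ZMod p → M) :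
    ∑ j ∈ Finset.Icc 1 p, F (j : ZMod p) = ∑ x : ZMod p, F x := by
  have hinj : Set.InjOn (fun j : ℕ => (j : ZMod p)) (Finset.Icc 1 p : Finset ℕ) := by
    intro i hi j hj hij
    simp only [Finset.coe_Icc, Set.mem_Icc] at hi hj
    have h := (ZMod.intCast_eq_intCast_iff_dvd_sub i j p).mp (by exact_mod_cast hij)
    have := Int.eq_zero_of_abs_lt_dvd h (by rw [abs_lt]; omega)
    omega
  refine Finset.sum_nbij (fun j : ℕ => (j : ZMod p)) (fun _ _ => Finset.mem_univ _) hinj ?_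
    fun _ _ => rfl
  exact Finset.surjOn_of_injOn_of_card_le _ (fun _ _ => Finset.mem_coe.2 (Finset.mem_univ _)) hinj
    (by simp [ZMod.card])

/-- The exponential form of the quadratic Gauss sum has square modulus `p` when `p ∤ ℓ`. -/
theorem norm_sq_sum_exp_sq {p : ℕ} (hp : p.Prime) (hp2 : p ≠ 2) {ℓ : ℤ} (hℓ : ¬ (p : ℤ) ∣ ℓ) :
    ‖∑ j ∈ Finset.Icc 1 p, Complex.exp (Complex.I *
      ((2 * π * (ℓ : ℝ) * (j : ℝ) ^ 2 / p : ℝ) : ℂ))‖ ^ 2 = (p : ℝ) := by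
  have : Fact p.Prime := ⟨hp⟩
  refine Eq.trans ?_ (norm_sq_sum_addChar_mul_sq hp2 (ZMod.isPrimitive_stdAddChar p)
    (a := (ℓ : ZMod p)) (by rwa [Ne, ZMod.intCast_zmod_eq_zero_iff_dvd]))
  rw [← sum_Icc_natCast_zmod]
  congr 2
  refine Finset.sum_congr rfl fun j _ => ?_
  have h := ZMod.stdAddChar_coe (N := p) (ℓ * (j : ℤ) ^ 2)
  push_cast at h
  rw [h]
  congr 1
  push_cast
  ring

/-- The Fourier transform of a dilate, in terms of `FT`. -/
theorem fourier_comp_natCast_mul (f : ℝ → ℝ) {p : ℕ} (hp : p ≠ 0) (ℓ : ℝ) :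
    FourierTransform.fourier (fun x : ℝ => (f (p * x) : ℂ)) ℓ =
      (1 / p : ℂ) * FT f (2 * π * ℓ / p) := by
  have hp' : (p : ℝ) ≠ 0 := by exact_mod_cast hp
  have hpc : (p : ℂ) ≠ 0 := by exact_mod_cast hp
  rw [Real.fourier_real_eq_integral_exp_smul, FT]
  have h := Measure.integral_comp_mul_left
    (fun x : ℝ => (f x : ℂ) * Complex.exp (-(Complex.I * x * (2 * π * ℓ / p : ℝ)))) (p : ℝ)
  rw [abs_of_nonneg (by positivity), Complex.real_smul] at h
  rw [one_div, ← Complex.ofReal_natCast, ← Complex.ofReal_inv, ← h]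
  congr 1 with x
  rw [smul_eq_mul, mul_comm]
  congr 2
  push_cast
  field_simp

/-- Poisson summation for a dilated Schwartz function. -/
theorem tsum_comp_natCast_mul (f : SchwartzMap ℝ ℝ) {p : ℕ} (hp : p ≠ 0)
    (hs : Summable fun ℓ : ℤ => FT f (2 * π * ℓ / p)) :
    ∑' n : ℤ, (f (p * n) : ℂ) = (1 / p : ℂ) * ∑' ℓ : ℤ, FT f (2 * π * ℓ / p) := by
  have hp' : (p : ℝ) ≠ 0 := by exact_mod_cast hp
  have hO : (fun x : ℝ => (f (p * x) : ℂ)) =O[cocompact ℝ] fun x : ℝ => |x| ^ (-2 : ℝ) := by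
    have h := (f.isBigO_cocompact_rpow (-2)).comp_tendsto
      (Homeomorph.mulLeft₀ (p : ℝ) hp').isClosedEmbedding.tendsto_cocompact
    rw [← Asymptotics.isBigO_norm_left]
    simp only [Complex.norm_real]
    refine h.norm_left.trans ?_
    refine Asymptotics.IsBigO.of_bound (|(p : ℝ)| ^ (-2 : ℝ)) (Eventually.of_forall fun x => ?_)
    simp only [Function.comp_apply, Homeomorph.coe_mulLeft₀, Real.norm_eq_abs, abs_mul]
    rw [Real.mul_rpow (abs_nonneg _) (abs_nonneg _), abs_mul,
      abs_of_nonneg (Real.rpow_nonneg (abs_nonneg (p : ℝ)) _)]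
  have h := Real.tsum_eq_tsum_fourier_of_rpow_decay_of_summable
    (f := fun x : ℝ => (f (p * x) : ℂ))
    (Complex.continuous_ofReal.comp (f.continuous.comp (continuous_const_mul _)))
    one_lt_two hO (by
      simp_rw [fourier_comp_natCast_mul f hp]
      exact hs.mul_left _) 0
  simp_rw [fourier_comp_natCast_mul f hp] at h
  simpa [tsum_mul_left] using h

/-- The sum of a Schwartz function over the lattice `pℤ` tends to its value at `0`. -/
theorem tendsto_tsum_comp_natCast_mul (f : SchwartzMap ℝ ℝ) :
    Tendsto (fun p : ℕ => ∑' n : ℤ, (f (p * n) : ℂ)) atTop (𝓝 (f 0 : ℂ)) := by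
  obtain ⟨C, hC0, hC⟩ := f.decay 2 0
  simp only [norm_iteratedFDeriv_zero, Real.norm_eq_abs, sq_abs] at hC
  have hbound : ∀ p : ℕ, 1 ≤ p → ∀ n : ℤ, n ≠ 0 → |f (p * n)| ≤ C * (1 / (n : ℝ) ^ 2) := by
    intro p hp n hn
    have hn' : 0 < (n : ℝ) ^ 2 := by positivity
    have hp' : (1 : ℝ) ≤ (p : ℝ) ^ 2 := one_le_pow₀ (by exact_mod_cast hp)
    rw [mul_one_div, le_div_iff₀ hn']
    nlinarith [hC (p * n), abs_nonneg (f (p * n)),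
      mul_nonneg (mul_nonneg (abs_nonneg (f (p * n))) hn'.le) (sub_nonneg.2 hp')]
  have hlim := tendsto_tsum_of_dominated_convergence (𝓕 := atTop)
    (f := fun (p : ℕ) (n : ℤ) => (f (p * n) : ℂ))
    (g := fun n : ℤ => if n = 0 then (f 0 : ℂ) else 0)
    (bound := fun n : ℤ => (if n = 0 then |f 0| else 0) + C * (1 / (n : ℝ) ^ 2))
    ((hasSum_ite_eq (0 : ℤ) |f 0|).summable.add
      ((Real.summable_one_div_int_pow.2 one_lt_two).mul_left C))
    (fun n => ?_) ?_
  · simpa using hlim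
  · by_cases hn : n = 0
    · simp [hn]
    · simp only [hn, if_false]
      have hn' : (n : ℝ) ≠ 0 := by exact_mod_cast hn
      have h0 : Tendsto f (cocompact ℝ) (𝓝 0) := f.toZeroAtInfty.zero_at_infty'
      have h1 : Tendsto (fun p : ℕ => (p : ℝ) * n) atTop (cocompact ℝ) :=
        (Homeomorph.mulRight₀ (n : ℝ) hn').isClosedEmbedding.tendsto_cocompact.comp
          (tendsto_natCast_atTop_atTop.mono_right atTop_le_cocompact)
      simpa [Function.comp_def] using (Complex.continuous_ofReal.tendsto 0).comp (h0.comp h1)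
  · filter_upwards [eventually_ge_atTop 1] with p hp n
    rw [Complex.norm_real, Real.norm_eq_abs]
    by_cases hn : n = 0
    · simp [hn]
    · simpa [hn] using hbound p hp n hn

/-- If `FT f` is supported in `(-2π, 2π)`, then `FT f (2πℓ/p) = 0` as soon as `p ≤ |ℓ|`. -/
theorem FT_eq_zero_of_le_abs {f : ℝ → ℝ}
    (hf : Function.support (FT f) ⊆ Set.Ioo (-(2 * π)) (2 * π)) {p : ℕ} (hp : p ≠ 0) {ℓ : ℤ}
    (hℓ : (p : ℤ) ≤ |ℓ|) : FT f (2 * π * ℓ / p) = 0 := by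
  by_contra h
  have hp' : (0 : ℝ) < p := by exact_mod_cast Nat.pos_of_ne_zero hp
  have hlt := abs_lt.2 (hf h)
  have hℓ' : (p : ℝ) ≤ |(ℓ : ℝ)| := by exact_mod_cast hℓ
  rw [abs_div, abs_mul, abs_of_pos Real.two_pi_pos, abs_of_pos hp', div_lt_iff₀ hp'] at hlt
  exact absurd hlt (not_lt.2 (mul_le_mul_of_nonneg_left hℓ' Real.two_pi_pos.le))

/-- Zelditch, Section 6 (Appendix, quadratic case): along the sequence of primes, the
off-diagonal pair correlation functional of the quantized map with eigenangles
`2πj²/p` tends to `f(0)`, i.e. 'the prime sequence is Poisson'. -/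
theorem prime_sequence_gauss_sums_poisson
    (f : SchwartzMap ℝ ℝ)
    (hf : Function.support (FT f) ⊆ Set.Ioo (-(2 * π)) (2 * π)) :
    Tendsto
      (fun p : ℕ =>
        ((1 / (p : ℝ) ^ 2 : ℝ) : ℂ) * ∑' ℓ : ℤ, (if ℓ = 0 then 0 else
          FT f (2 * π * ℓ / p) *
            ((‖∑ j ∈ Finset.Icc 1 p, Complex.exp (Complex.I *
                ((2 * π * (ℓ : ℝ) * (j : ℝ) ^ 2 / p : ℝ) : ℂ))‖ ^ 2 : ℝ) : ℂ)))
      (atTop ⊓ Filter.principal {p : ℕ | p.Prime}) (𝓝 ((f 0 : ℂ))) := by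
  set g : ℕ → ℤ → ℂ := fun p ℓ => FT f (2 * π * ℓ / p) with hg
  have hsum : ∀ p : ℕ, p ≠ 0 → Summable (g p) := fun p hp =>
    summable_of_ne_finset_zero (s := Finset.Ioo (-(p : ℤ)) p) fun ℓ hℓ =>
      FT_eq_zero_of_le_abs hf hp (not_lt.1 fun h => hℓ (Finset.mem_Ioo.2 (abs_lt.1 h)))
  have hlim : Tendsto (fun p : ℕ => ∑' n : ℤ, (f (p * n) : ℂ) - (1 / p : ℂ) * FT f 0)
      (atTop ⊓ Filter.principal {p : ℕ | p.Prime}) (𝓝 (f 0 : ℂ)) := by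
    have h := (tendsto_tsum_comp_natCast_mul f).sub
      ((tendsto_one_div_atTop_nhds_zero_nat (𝕜 := ℂ)).mul_const (FT f 0))
    rw [zero_mul, sub_zero] at h
    exact h.mono_left inf_le_left
  refine hlim.congr' ?_
  filter_upwards [mem_inf_of_left (eventually_gt_atTop 2),
    mem_inf_of_right (mem_principal_self _)] with p hp2 hp
  have hp : p.Prime := hp
  have hp0 : (p : ℂ) ≠ 0 := by exact_mod_cast hp.ne_zero
  have hterm : ∀ ℓ : ℤ, (if ℓ = 0 then 0 else FT f (2 * π * ℓ / p) *
      ((‖∑ j ∈ Finset.Icc 1 p, Complex.exp (Complex.I *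
        ((2 * π * (ℓ : ℝ) * (j : ℝ) ^ 2 / p : ℝ) : ℂ))‖ ^ 2 : ℝ) : ℂ))
      = (p : ℂ) * (if ℓ = 0 then 0 else g p ℓ) := by
    intro ℓ
    by_cases hℓ : ℓ = 0
    · simp [hℓ]
    rw [if_neg hℓ, if_neg hℓ]
    by_cases hle : (p : ℤ) ≤ |ℓ|
    · simp only [hg, FT_eq_zero_of_le_abs hf hp.ne_zero hle, zero_mul, mul_zero]
    · rw [norm_sq_sum_exp_sq hp hp2.ne' fun h =>
        hℓ (Int.eq_zero_of_abs_lt_dvd h (not_le.1 hle)), Complex.ofReal_natCast, mul_comm]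
  simp_rw [hterm]
  rw [tsum_mul_left, tsum_comp_natCast_mul f hp.ne_zero (hsum p hp.ne_zero),
    (hsum p hp.ne_zero).tsum_eq_add_tsum_ite 0]
  have hg0 : g p 0 = FT f 0 := by simp [hg]
  rw [hg0]
  push_cast
  field_simp
  ring
end
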